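/- arXiv:2301.00171 — 4 statements merged into one kernel-verified Lean document; each statement's English description precedes it below -/
import Mathlib

section
/- Let G = G_1 ∗ ⋯ ∗ G_n be a free product of finitely generated groups. Then every automorphism of G has finitely generated fixed subgroup if and only if, for each i ∈ {1,…,n}, every automorphism of G_i has finitely generated fixed subgroup. -/
/-- The fixed subgroup of an endomorphism. -/
def fixedSubgroup {G : Type*} [Group G] (φ : G →* G) : Subgroup G where
  carrier := {g | φ g = g}
  one_mem' := by simp
  mul_mem' := by
    intro a b ha hb
    simp only [Set.mem_setOf_eq, map_mul] at *
    rw [ha, hb]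
  inv_mem' := by
    intro a ha
    simp only [Set.mem_setOf_eq, map_inv] at *
    rw [ha]

open Monoid

/-- A family of subgroups whose free product maps isomorphically onto the whole group. -/
def IsFreeDecomposition {G ι : Type*} [Group G] (S : ι → Subgroup G) : Prop :=
  Function.Bijective (CoprodI.lift fun i => (S i).subtype)

/-- The inclusion of a member of a family of subgroups into the free product of the family. -/
def ofFactor {G ι : Type*} [Group G] (S : ι → Subgroup G) (i : ι) :
    S i →* CoprodI fun i => S i :=
  CoprodI.of (M := fun i => S i)

namespace IsFreeDecomposition

variable {G ι : Type*} [Group G] {S : ι → Subgroup G}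

theorem iSup_eq_top (hS : IsFreeDecomposition S) : ⨆ i, S i = ⊤ := by
  have h := CoprodI.range_eq_iSup (G := fun i => S i) (fun i => (S i).subtype)
  rw [MonoidHom.range_eq_top.2 hS.2] at h
  simpa using h.symm

theorem exists_mulEquiv (hS : IsFreeDecomposition S) :
    ∃ e : G ≃* CoprodI (fun i => S i), ∀ i (s : S i), e s = ofFactor S i s := by
  refine ⟨(MulEquiv.ofBijective _ hS).symm, fun i s => ?_⟩
  rw [MulEquiv.symm_apply_eq]
  exact (CoprodI.lift_of (fun i => (S i).subtype) s).symm

theorem exists_extend (hS : IsFreeDecomposition S) {K : Type*} [Group K] (f : ∀ i, S i →* K) :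
    ∃ F : G →* K, ∀ i (s : S i), F s = f i s := by
  obtain ⟨e, he⟩ := hS.exists_mulEquiv
  exact ⟨(CoprodI.lift f).comp e.toMonoidHom, fun i s => by simp [he, ofFactor]⟩

theorem of_extend (htop : ⨆ i, S i = ⊤) (F : G →* CoprodI (fun i => S i))
    (hF : ∀ i (s : S i), F s = ofFactor S i s) : IsFreeDecomposition S := by
  constructor
  · have : F.comp (CoprodI.lift fun i => (S i).subtype) = MonoidHom.id _ := by
      ext i s
      simp [hF, ofFactor]
    intro x y hxy
    have h := congrArg F hxy
    simpa using (DFunLike.congr_fun this x).symm.trans (h.trans (DFunLike.congr_fun this y))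
  · rw [← MonoidHom.range_eq_top, CoprodI.range_eq_iSup]
    simpa using htop

theorem hom_ext (hS : IsFreeDecomposition S) {K : Type*} [Group K] {f g : G →* K}
    (h : ∀ i, ∀ s ∈ S i, f s = g s) : f = g := by
  refine MonoidHom.eq_of_eqOn_top ?_
  rw [← hS.iSup_eq_top]
  change (⨆ i, S i) ≤ f.eqLocus g
  exact iSup_le fun i s hs => h i s hs

theorem map_equiv (hS : IsFreeDecomposition S) {G' : Type*} [Group G'] (e : G ≃* G') :
    IsFreeDecomposition (fun i => (S i).map e.toMonoidHom) := by
  obtain ⟨F, hF⟩ := hS.exists_extend (K := CoprodI fun i => (S i).map e.toMonoidHom)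
    (fun i => (ofFactor (fun i => (S i).map e.toMonoidHom) i).comp
      ((S i).equivMapOfInjective e.toMonoidHom e.injective).toMonoidHom)
  refine of_extend ?_ (F.comp e.symm.toMonoidHom) ?_
  · rw [← Subgroup.map_iSup, hS.iSup_eq_top, ← MonoidHom.range_eq_map]
    exact MonoidHom.range_eq_top.2 e.surjective
  · rintro i ⟨_, s, hs, rfl⟩
    have h : F (e.symm (e s)) = F s := by rw [e.symm_apply_apply]
    exact h.trans (hF i ⟨s, hs⟩)

/-- The images of the factors decompose a free product. -/
theorem range_of {M : ι → Type*} [∀ i, Group (M i)] :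
    IsFreeDecomposition (fun i => (CoprodI.of : M i →* CoprodI M).range) := by
  refine of_extend ?_ (CoprodI.lift fun i =>
    (ofFactor (fun i => (CoprodI.of : M i →* CoprodI M).range) i).comp
      (CoprodI.of : M i →* CoprodI M).rangeRestrict) ?_
  · rw [← CoprodI.range_eq_iSup, CoprodI.lift_of']
    exact MonoidHom.range_eq_top.2 Function.surjective_id
  · rintro i ⟨_, s, rfl⟩
    simp [MonoidHom.rangeRestrict]
    rfl

/-- Each factor of a free decomposition can be decomposed further. -/
theorem sigma (hS : IsFreeDecomposition S) {J : ι → Type*} {R : ∀ i, J i → Subgroup (S i)}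
    (hR : ∀ i, IsFreeDecomposition (R i)) :
    IsFreeDecomposition (fun p : Σ i, J i => (R p.1 p.2).map (S p.1).subtype) := by
  have h (i : ι) := (hR i).exists_extend
    (K := CoprodI fun p : Σ i, J i => (R p.1 p.2).map (S p.1).subtype)
    (fun j => (ofFactor (fun p : Σ i, J i => (R p.1 p.2).map (S p.1).subtype) ⟨i, j⟩).comp
      ((R i j).equivMapOfInjective (S i).subtype (S i).subtype_injective).toMonoidHom)
  choose f hf using h
  obtain ⟨F, hF⟩ := hS.exists_extend f
  refine of_extend ?_ F ?_
  · rw [iSup_sigma, ← hS.iSup_eq_top]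
    refine iSup_congr fun i => ?_
    change ⨆ j, (R i j).map (S i).subtype = S i
    rw [← Subgroup.map_iSup, (hR i).iSup_eq_top, ← MonoidHom.range_eq_map, Subgroup.range_subtype]
  · rintro ⟨i, j⟩ ⟨_, s, hs, rfl⟩
    have h1 := hF i s
    have h2 := hf i j ⟨s, hs⟩
    rw [h2] at h1
    exact h1

/-- One factor of a free decomposition splits off from the join of all the others. -/
theorem bool (hS : IsFreeDecomposition S) (i₀ : ι) :
    IsFreeDecomposition (fun b : Bool => if b then S i₀ else ⨆ i ≠ i₀, S i) := by
  classical
  set T : Bool → Subgroup G := fun b => if b then S i₀ else ⨆ i ≠ i₀, S i with hT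
  have hle (i : ι) : S i ≤ T (decide (i = i₀)) := by
    by_cases h : i = i₀
    · simp [hT, h]
    · simp only [hT, h, decide_false]
      exact le_iSup₂_of_le (f := fun i (_ : i ≠ i₀) => S i) i h le_rfl
  obtain ⟨F, hF⟩ := hS.exists_extend
    (fun i => (ofFactor T (decide (i = i₀))).comp (Subgroup.inclusion (hle i)))
  have key (b : Bool) (i : ι) (hb : decide (i = i₀) = b) (s : G) (hs : s ∈ S i) (hs' : s ∈ T b) :
      F s = ofFactor T b ⟨s, hs'⟩ := by
    subst hb
    exact hF i ⟨s, hs⟩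
  refine of_extend ?_ F ?_
  · refine top_le_iff.1 (hS.iSup_eq_top.ge.trans (iSup_le fun i => (hle i).trans ?_))
    exact le_iSup T _
  · rintro (_ | _) ⟨s, hs⟩
    · have hsub : (⨆ i ≠ i₀, S i) ≤ Subgroup.map (T false).subtype
          ((F.comp (T false).subtype).eqLocus (ofFactor T false)) := by
        refine iSup₂_le fun i hi t ht => ?_
        have ht' : t ∈ T false := by simpa [hi] using hle i ht
        exact ⟨⟨t, ht'⟩, key false i (by simp [hi]) t ht ht', rfl⟩
      obtain ⟨⟨t, ht⟩, h1, h2⟩ := hsub (show s ∈ ⨆ i ≠ i₀, S i by simpa [hT] using hs)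
      obtain rfl : t = s := h2
      exact h1
    · exact key true i₀ (by simp) s (by simpa [hT] using hs) hs

end IsFreeDecomposition

namespace Monoid.CoprodI

variable {ι : Type*} {M : ι → Type*} [∀ i, Group (M i)] [DecidableEq ι] [∀ i, DecidableEq (M i)]

/-- The first letter of the normal form if it lies in the factor `j`, and `1` otherwise. -/
def leading (j : ι) (x : CoprodI M) : M j :=
  (Word.equivPair j (Word.equiv x)).head

theorem equiv_mul (x y : CoprodI M) : Word.equiv (x * y) = x • Word.equiv y := by
  change (x * y) • (Word.empty : Word M) = x • y • (Word.empty : Word M)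
  exact mul_smul x y _

theorem leading_of_mul (j : ι) (h : M j) (x : CoprodI M) :
    leading j (of h * x) = h * leading j x := by
  rw [leading, equiv_mul, Word.equivPair_smul_same]
  rfl

theorem leading_one (j : ι) : leading j (1 : CoprodI M) = 1 := by
  have : Word.equiv (1 : CoprodI M) = Word.empty := by
    change (1 : CoprodI M) • (Word.empty : Word M) = Word.empty
    exact one_smul _ _
  rw [leading, this, Word.equivPair_eq_of_fstIdx_ne (by simp [Word.fstIdx, Word.empty])]

theorem fstIdx_of_leading_ne_one {j : ι} {x : CoprodI M} (h : leading j x ≠ 1) :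
    (Word.equiv x).fstIdx = some j := by
  by_contra hne
  exact h (by rw [leading, Word.equivPair_eq_of_fstIdx_ne hne])

theorem index_eq_of_leading_ne_one {i j : ι} {x : CoprodI M} (hi : leading i x ≠ 1)
    (hj : leading j x ≠ 1) : i = j :=
  Option.some_injective _
    ((fstIdx_of_leading_ne_one hi).symm.trans (fstIdx_of_leading_ne_one hj))

theorem leading_of_mul_of_ne {j k : ι} (hkj : k ≠ j) (m : M k) (x : CoprodI M)
    (h : m * leading k x ≠ 1) : leading j (of m * x) = 1 := by
  by_contra hne
  refine hkj (index_eq_of_leading_ne_one ?_ hne)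
  rwa [leading_of_mul]

theorem leading_of_of_ne {i j : ι} (hij : i ≠ j) (s : M i) :
    leading j (of s : CoprodI M) = 1 := by
  by_cases hs : s = 1
  · simp [hs, leading_one]
  · have := leading_of_mul_of_ne hij s 1 (by simpa [leading_one] using hs)
    simpa using this

theorem leading_prod {w : Word M} {k : ι} (hw : w.fstIdx ≠ some k) : leading k w.prod = 1 := by
  have : Word.equiv w.prod = w := Word.equiv.apply_symm_apply w
  rw [leading, this, Word.equivPair_eq_of_fstIdx_ne hw]

/-- Multiplying on the right by a letter changes the leading letter only within that factor. -/
theorem leading_mul_of {i : ι} (s : M i) (x : CoprodI M) (j : ι)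
    (h : i = j → x ∉ (of : M j →* CoprodI M).range) :
    leading j (x * of s) = leading j x := by
  obtain ⟨w, rfl⟩ : ∃ w : Word M, w.prod = x := ⟨_, Word.equiv.symm_apply_apply x⟩
  induction w using Word.consRecOn generalizing j with
  | empty =>
    have hij : i ≠ j := fun hij => h hij (by simp)
    simp [leading_of_of_ne hij, leading_one]
  | cons k m w h1 h2 ih =>
    rw [Word.prod_cons, mul_assoc]
    by_cases hkj : k = j
    · subst hkj
      rw [leading_of_mul, leading_of_mul, ih]
      rintro hik ⟨y, hy⟩
      exact h hik ⟨m * y, by rw [map_mul, hy, Word.prod_cons]⟩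
    · rw [leading_of_mul_of_ne hkj m w.prod (by simpa [leading_prod h1] using h2)]
      by_cases hex : i = k ∧ w.prod ∈ (of : M k →* CoprodI M).range
      · obtain ⟨rfl, y, hy⟩ := hex
        rw [← hy, ← map_mul, ← map_mul, leading_of_of_ne hkj]
      · refine leading_of_mul_of_ne hkj _ _ ?_
        rw [ih k fun h1 h2 => hex ⟨h1, h2⟩, leading_prod h1]
        simpa using h2

end Monoid.CoprodI

/-- The leading letters of normal forms, expressed inside a group with a free decomposition. -/
structure LeadingLetters {G ι : Type*} [Group G] (S : ι → Subgroup G) where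
  /-- The leading letter in the factor `j`, which is trivial when there is none. -/
  toFun : ∀ j, G → S j
  map_mul : ∀ j (h : S j) g, toFun j (h * g) = h * toFun j g
  map_one : ∀ j, toFun j 1 = 1
  index_eq : ∀ {i j g}, toFun i g ≠ 1 → toFun j g ≠ 1 → i = j
  mul_right : ∀ {i} (s : S i) (g : G) (j : ι), (i = j → g ∉ S j) →
    toFun j (g * s) = toFun j g

theorem IsFreeDecomposition.nonempty_leadingLetters {G ι : Type*} [Group G] {S : ι → Subgroup G}
    (hS : IsFreeDecomposition S) : Nonempty (LeadingLetters S) := by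
  classical
  obtain ⟨e, he⟩ := hS.exists_mulEquiv
  let lam (j : ι) (g : G) : S j := CoprodI.leading (M := fun i => S i) j (e g)
  have hl {i : ι} (s : S i) (g : G) : e (s * g) = ofFactor S i s * e g := by rw [map_mul, he]
  have hr {i : ι} (s : S i) (g : G) : e (g * s) = e g * ofFactor S i s := by rw [map_mul, he]
  refine ⟨⟨lam, fun j h g => ?_, fun j => ?_, fun {i j g} hi hj => ?_, fun {i} s g j h => ?_⟩⟩
  · change CoprodI.leading (M := fun i => S i) j (e (h * g)) = _
    rw [hl]
    exact CoprodI.leading_of_mul (M := fun i => S i) j h (e g)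
  · change CoprodI.leading (M := fun i => S i) j (e 1) = 1
    rw [map_one]
    exact CoprodI.leading_one (M := fun i => S i) j
  · exact CoprodI.index_eq_of_leading_ne_one (M := fun i => S i) hi hj
  · change CoprodI.leading (M := fun i => S i) j (e (g * s)) = _
    rw [hr]
    refine CoprodI.leading_mul_of (M := fun i => S i) s (e g) j fun hij hmem => h hij ?_
    obtain ⟨y, hy⟩ := hmem
    rw [← e.injective ((he j y).trans hy)]
    exact y.2

namespace LeadingLetters

variable {G ι : Type*} [Group G] {S : ι → Subgroup G}

/-- Conjugates of free factors intersect trivially, except for the obvious coincidences. -/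
theorem malnormal (L : LeadingLetters S) {i j : ι} {g h : G} (hh : h ∈ S j) (h1 : h ≠ 1) {k : G}
    (hk : k ∈ S i) (hgk : h * g = g * k) : i = j ∧ g ∈ S j := by
  by_contra hne
  have h2 := L.mul_right ⟨k, hk⟩ g j (fun hij hg => hne ⟨hij, hg⟩)
  have h3 := L.map_mul j ⟨h, hh⟩ g
  change L.toFun j (g * k) = _ at h2
  change L.toFun j (h * g) = _ at h3
  rw [hgk, h2] at h3
  have : (⟨h, hh⟩ : S j) = 1 := by simpa using h3.symm
  exact h1 (congrArg Subtype.val this)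

/-- Right translation changes the leading letter in the factor `j` only on finitely many
right cosets of that factor. -/
theorem finite_mul_right (L : LeadingLetters S) (htop : ⨆ i, S i = ⊤) (j : ι) (u : G) :
    ∃ Z : Set G, Z.Finite ∧
      ∀ g, L.toFun j (g * u) ≠ L.toFun j g → ∃ h : S j, ∃ z ∈ Z, g = h * z := by
  have hu : u ∈ ⨆ i, S i := htop ▸ Subgroup.mem_top u
  induction hu using Subgroup.iSup_induction' with
  | hp i s hs =>
    refine ⟨{1}, Set.finite_singleton 1, fun g hg => ?_⟩
    by_contra hne
    refine hg (L.mul_right ⟨s, hs⟩ g j fun _ hgj => hne ⟨⟨g, hgj⟩, 1, rfl, by simp⟩)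
  | h1 => exact ⟨∅, Set.finite_empty, fun g hg => by simp at hg⟩
  | hmul u v _ _ hu hv =>
    obtain ⟨Y, hY, hYu⟩ := hu
    obtain ⟨Z, hZ, hZv⟩ := hv
    refine ⟨Y ∪ (fun z => z * u⁻¹) '' Z, hY.union (hZ.image _), fun g hg => ?_⟩
    by_cases h1 : L.toFun j (g * u) = L.toFun j g
    · obtain ⟨h, z, hz, hgz⟩ := hZv (g * u) (by rwa [h1, mul_assoc])
      exact ⟨h, z * u⁻¹, Or.inr ⟨z, hz, rfl⟩, by rw [← mul_assoc, ← hgz]; simp⟩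
    · obtain ⟨h, z, hz, hgz⟩ := hYu g h1
      exact ⟨h, z, Or.inl hz, hgz⟩

/-- Only finitely many elements acquire a leading letter in a given factor upon right translation
by a fixed element. -/
theorem finite_leading_eq_one (L : LeadingLetters S) (htop : ⨆ i, S i = ⊤) (j : ι) (u : G) :
    {g | L.toFun j g = 1 ∧ L.toFun j (g * u) ≠ 1}.Finite := by
  obtain ⟨Z, hZ, h⟩ := L.finite_mul_right htop j u
  refine (hZ.image fun z => ((L.toFun j z)⁻¹ : S j) * z).subset ?_
  rintro g ⟨h1, h2⟩
  obtain ⟨s, z, hz, rfl⟩ := h g (by rwa [h1])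
  refine ⟨z, hz, ?_⟩
  rw [L.map_mul] at h1
  simp only [← eq_inv_of_mul_eq_one_left h1]

end LeadingLetters

/-- `Conn S x a y` says that the arcs in `S`, labelled by elements of a group, contain an
unoriented path from `x` to `y` with label product `a`. -/
inductive Conn {X A : Type*} [Group A] (S : Set (X × A × X)) : X → A → X → Prop
  | refl (x : X) : Conn S x 1 x
  | of {x : X} {a : A} {y : X} : (x, a, y) ∈ S → Conn S x a y
  | symm {x : X} {a : A} {y : X} : Conn S x a y → Conn S y a⁻¹ x
  | trans {x : X} {a : A} {y : X} {b : A} {z : X} :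
      Conn S x a y → Conn S y b z → Conn S x (a * b) z

namespace Conn

variable {X Y A B : Type*} [Group A] [Group B] {S : Set (X × A × X)} {T : Set (Y × B × Y)}

theorem of_eq {x y : X} {a b : A} (h : Conn S x a y) (hab : a = b) : Conn S x b y := hab ▸ h

/-- Transport of paths along a map of vertices and a twisted map of labels. -/
theorem map (ρ : X → Y) (u : X → B) (f : A →* B)
    (h : ∀ x a y, (x, a, y) ∈ S → Conn T (ρ x) ((u x)⁻¹ * f a * u y) (ρ y))
    {x y : X} {a : A} (hxy : Conn S x a y) : Conn T (ρ x) ((u x)⁻¹ * f a * u y) (ρ y) := by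
  induction hxy with
  | refl x => exact (Conn.refl _).of_eq (by simp)
  | of hs => exact h _ _ _ hs
  | symm _ ih => exact ih.symm.of_eq (by simp [mul_assoc])
  | trans _ _ ih1 ih2 => exact (ih1.trans ih2).of_eq (by simp [mul_assoc])

theorem map_hom (ρ : X → Y) (f : A →* B) (h : ∀ x a y, (x, a, y) ∈ S → Conn T (ρ x) (f a) (ρ y))
    {x y : X} {a : A} (hxy : Conn S x a y) : Conn T (ρ x) (f a) (ρ y) :=
  (hxy.map ρ (fun _ => 1) f fun x a y hs => (h x a y hs).of_eq (by simp)).of_eq (by simp)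

theorem mono {S' : Set (X × A × X)} (h : S ⊆ S') {x y : X} {a : A} (hxy : Conn S x a y) :
    Conn S' x a y :=
  hxy.map_hom id (MonoidHom.id A) fun _ _ _ hs => .of (h hs)

theorem iff_of_arcs {P : X → Prop} (h : ∀ x a y, (x, a, y) ∈ S → (P x ↔ P y)) {x y : X} {a : A}
    (hxy : Conn S x a y) : P x ↔ P y := by
  induction hxy with
  | refl x => rfl
  | of hs => exact h _ _ _ hs
  | symm _ ih => exact ih.symm
  | trans _ _ ih1 ih2 => exact ih1.trans ih2

/-- A path entering or leaving a set of vertices has an arc crossing its boundary. -/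
theorem exists_crossing (P : X → Prop) {x y : X} {a : A} (hxy : Conn S x a y) (hx : P x)
    (hy : ¬ P y) : ∃ p b q, P p ∧ ¬ P q ∧ ((p, b, q) ∈ S ∨ (q, b⁻¹, p) ∈ S) := by
  by_contra! hne
  refine hy ((hxy.iff_of_arcs fun p b q hs => ?_).1 hx)
  by_contra hpq
  by_cases hp : P p
  · exact (hne p b q hp (by tauto)).1 hs
  · exact (hne q b⁻¹ p (by tauto) hp).2 (by simpa using hs)

end Conn

namespace Grushko

variable {ι : Type*} {M : ι → Type*} [∀ i, Group (M i)]

/-- The arcs of a family of labelled graphs, labelled in the free product. -/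
def arcs (S : ∀ i, Multiset (ℕ × M i × ℕ)) : Set (ℕ × CoprodI M × ℕ) :=
  {p | ∃ i m, (p.1, m, p.2.2) ∈ S i ∧ p.2.1 = CoprodI.of m}

theorem arcs_mono {S S' : ∀ i, Multiset (ℕ × M i × ℕ)} (h : ∀ i, S i ⊆ S' i) :
    arcs S ⊆ arcs S' := by
  rintro ⟨x, g, y⟩ ⟨i, m, hm, hg⟩
  exact ⟨i, m, h i hm, hg⟩

theorem conn_arcs {S : ∀ i, Multiset (ℕ × M i × ℕ)} {i : ι} {x y : ℕ} {m : M i}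
    (h : Conn {p | p ∈ S i} x m y) : Conn (arcs S) x (CoprodI.of m) y :=
  h.map_hom (T := arcs S) id (CoprodI.of : M i →* CoprodI M) fun _ m _ hs => .of ⟨i, m, hs, rfl⟩

/-- A connected finite graph on the vertices `V`, with base point `0`, whose arcs carry labels in
the factors of a free product. -/
structure IsGraph (S : ∀ i, Multiset (ℕ × M i × ℕ)) (V : Finset ℕ) : Prop where
  zero_mem : 0 ∈ V
  left_mem : ∀ {i p}, p ∈ S i → p.1 ∈ V
  right_mem : ∀ {i p}, p ∈ S i → p.2.2 ∈ V
  conn : ∀ x ∈ V, ∃ g, Conn (arcs S) 0 g x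

theorem sum_card_update_cons {ι : Type*} [Fintype ι] [DecidableEq ι] {α : ι → Type*}
    (S : ∀ i, Multiset (α i)) (i : ι) (p : α i) :
    ∑ k, (Function.update S i (p ::ₘ S i) k).card = ∑ k, (S k).card + 1 := by
  have h (S : ∀ i, Multiset (α i)) :=
    (Finset.add_sum_erase Finset.univ (fun k => (S k).card) (Finset.mem_univ i)).symm
  rw [h, h S, Finset.sum_congr rfl fun k hk => by
    rw [Function.update_of_ne (Finset.ne_of_mem_erase hk)]]
  simp
  ring

theorem subset_update_cons {ι : Type*} [DecidableEq ι] {α : ι → Type*} (S : ∀ i, Multiset (α i))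
    (i : ι) (p : α i) (k : ι) :
    S k ⊆ Function.update S i (p ::ₘ S i) k := by
  by_cases hk : k = i
  · subst hk
    rw [Function.update_self]
    exact Multiset.subset_cons _ _
  · rw [Function.update_of_ne hk]
    exact fun _ h => h

section Path

variable [DecidableEq ι]

theorem IsGraph.update_cons {S : ∀ i, Multiset (ℕ × M i × ℕ)} {V : Finset ℕ} (h : IsGraph S V)
    (i : ι) (x : ℕ) (m : M i) (z : ℕ) (hx : x ∈ V) :
    IsGraph (Function.update S i ((x, m, z) ::ₘ S i)) (insert z V) := by
  have hmem {k : ι} {p : ℕ × M k × ℕ} (hp : p ∈ Function.update S i ((x, m, z) ::ₘ S i) k) :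
      (p.1 ∈ V ∧ p.2.2 ∈ V) ∨ (p.1 = x ∧ p.2.2 = z) := by
    by_cases hk : k = i
    · subst hk
      simp only [Function.update_self, Multiset.mem_cons] at hp
      rcases hp with rfl | hp
      · simp
      · exact Or.inl ⟨h.left_mem hp, h.right_mem hp⟩
    · rw [Function.update_of_ne hk] at hp
      exact Or.inl ⟨h.left_mem hp, h.right_mem hp⟩
  refine ⟨by simp [h.zero_mem], fun {k p} hp => ?_, fun {k p} hp => ?_, fun y hy => ?_⟩
  · rcases hmem hp with h | h <;> aesop
  · rcases hmem hp with h | h <;> aesop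
  · have hold (y : ℕ) (hy : y ∈ V) :
        ∃ g, Conn (arcs (Function.update S i ((x, m, z) ::ₘ S i))) 0 g y := by
      obtain ⟨g, hg⟩ := h.conn y hy
      exact ⟨g, hg.mono (arcs_mono (subset_update_cons S i _))⟩
    rcases Finset.mem_insert.1 hy with rfl | hy
    · obtain ⟨g, hg⟩ := hold x hx
      exact ⟨_, hg.trans (.of ⟨i, m, by simp, rfl⟩)⟩
    · exact hold y hy

variable [Fintype ι]

/-- Any element of a free product can be read along a path attached to a given vertex. -/
theorem exists_path (g : CoprodI M) (S : ∀ i, Multiset (ℕ × M i × ℕ)) (V : Finset ℕ)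
    (h : IsGraph S V) (x : ℕ) (hx : x ∈ V) :
    ∃ (S' : ∀ i, Multiset (ℕ × M i × ℕ)) (V' : Finset ℕ), IsGraph S' V' ∧ (∀ i, S i ⊆ S' i) ∧
      ∑ i, (S' i).card + V.card = ∑ i, (S i).card + V'.card ∧
      ∃ z ∈ V', Conn (arcs S') x g z := by
  induction g using CoprodI.induction_on generalizing S V x with
  | one => exact ⟨S, V, h, fun _ _ h => h, rfl, x, hx, .refl x⟩
  | of i m =>
    obtain ⟨z, hz⟩ := Infinite.exists_notMem_finset V
    refine ⟨_, _, h.update_cons i x m z hx, subset_update_cons S i _, ?_, z, by simp,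
      .of ⟨i, m, by simp, rfl⟩⟩
    rw [sum_card_update_cons, Finset.card_insert_of_notMem hz]
    ring
  | mul a b iha ihb =>
    obtain ⟨S₁, V₁, h₁, hs₁, hc₁, z₁, hz₁, hp₁⟩ := iha S V h x hx
    obtain ⟨S₂, V₂, h₂, hs₂, hc₂, z₂, hz₂, hp₂⟩ := ihb S₁ V₁ h₁ z₁ hz₁
    exact ⟨S₂, V₂, h₂, fun i p hp => hs₂ i (hs₁ i hp), by omega, z₂, hz₂,
      (hp₁.mono (arcs_mono hs₂)).trans hp₂⟩

theorem exists_graph [Nonempty ι] (s : Finset (CoprodI M)) :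
    ∃ (S : ∀ i, Multiset (ℕ × M i × ℕ)) (V : Finset ℕ), IsGraph S V ∧
      (∀ g ∈ s, Conn (arcs S) 0 g 0) ∧ ∑ i, (S i).card + 1 ≤ s.card + V.card := by
  classical
  induction s using Finset.induction_on with
  | empty =>
    refine ⟨fun _ => 0, {0}, ⟨by simp, by simp, by simp, fun x hx => ⟨1, ?_⟩⟩, by simp, by simp⟩
    rw [Finset.mem_singleton.1 hx]
    exact .refl 0
  | insert g s hg ih =>
    obtain ⟨S, V, h, hs, hc⟩ := ih
    obtain ⟨S', V', h', hs', hc', z, hz, hp⟩ := exists_path g S V h 0 h.zero_mem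
    obtain ⟨i⟩ := ‹Nonempty ι›
    have h2 := h'.update_cons i z 1 0 hz
    rw [Finset.insert_eq_of_mem h'.zero_mem] at h2
    have hle := arcs_mono (subset_update_cons S' i (z, 1, 0))
    refine ⟨_, V', h2, fun a ha => ?_, ?_⟩
    · rcases Finset.mem_insert.1 ha with rfl | ha
      · exact ((hp.mono hle).trans (conn_arcs (m := (1 : M i)) (.of (by simp)))).of_eq (by simp)
      · exact ((hs a ha).mono (arcs_mono hs')).mono hle
    · rw [sum_card_update_cons, Finset.card_insert_of_notMem hg]
      omega

end Path

end Grushko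

namespace Grushko

variable {ι : Type*} {M : ι → Type*} [∀ i, Group (M i)]

/-- Contracting an arc of a labelled graph. -/
theorem conn_contract {A : Type*} [Group A] {R : Multiset (ℕ × A × ℕ)} {s : ℕ × A × ℕ}
    {x y : ℕ} {a : A} (hxy : y ≠ x) (hs : s = (x, a, y) ∨ s = (y, a⁻¹, x)) :
    ∃ R' : Multiset (ℕ × A × ℕ), R'.card = R.card ∧
      (∀ V : Finset ℕ, y ∈ V → (∀ p ∈ R, p.1 ∈ V ∧ p.2.2 ∈ V) →
        ∀ p ∈ R', p.1 ∈ V.erase x ∧ p.2.2 ∈ V.erase x) ∧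
      ∀ p b q, p ≠ x → q ≠ x → Conn {p | p ∈ s ::ₘ R} p b q → Conn {p | p ∈ R'} p b q := by
  let ρ : ℕ → ℕ := Function.update id x y
  let u : ℕ → A := Function.update 1 x a
  have hρ {p : ℕ} (hp : p ≠ x) : ρ p = p := by simp [ρ, Function.update_of_ne hp]
  have hu {p : ℕ} (hp : p ≠ x) : u p = 1 := by simp [u, Function.update_of_ne hp]
  have hρx : ρ x = y := by simp [ρ]
  have hux : u x = a := by simp [u]
  refine ⟨R.map fun p => (ρ p.1, (u p.1)⁻¹ * p.2.1 * u p.2.2, ρ p.2.2), by simp, ?_, ?_⟩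
  · intro V hy hR p hp
    have hρV (z : ℕ) (hz : z ∈ V) : ρ z ∈ V.erase x := by
      by_cases hzx : z = x
      · subst hzx
        rw [hρx]
        exact Finset.mem_erase.2 ⟨hxy, hy⟩
      · rw [hρ hzx]
        exact Finset.mem_erase.2 ⟨hzx, hz⟩
    obtain ⟨r, hr, rfl⟩ := Multiset.mem_map.1 hp
    exact ⟨hρV _ (hR r hr).1, hρV _ (hR r hr).2⟩
  · intro p b q hp hq hpq
    have := hpq.map (T := {p | p ∈ R.map fun p => (ρ p.1, (u p.1)⁻¹ * p.2.1 * u p.2.2, ρ p.2.2)})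
      ρ u (MonoidHom.id A) fun p b q hm => ?_
    · rw [hρ hp, hρ hq, hu hp, hu hq] at this
      simpa using this
    · rcases Multiset.mem_cons.1 hm with h | h
      · rw [← h] at hs
        rcases hs with hs | hs <;> obtain ⟨rfl, rfl, rfl⟩ : _ ∧ _ ∧ _ := by simpa using hs
        · rw [hρx, hρ hxy, hux, hu hxy]
          exact (Conn.refl _).of_eq (by simp)
        · rw [hρx, hρ hxy, hux, hu hxy]
          exact (Conn.refl _).of_eq (by simp)
      · exact .of (Multiset.mem_map.2 ⟨_, h, rfl⟩)

/-- Folding a graph at a path that spells the trivial element of a factor. -/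
theorem fold [Fintype ι] {S : ∀ i, Multiset (ℕ × M i × ℕ)} {V : Finset ℕ} (h : IsGraph S V)
    {i : ι} {x x' : ℕ} (hx' : x' ≠ 0) (hne : x' ≠ x) (hV : x' ∈ V)
    (hfold : Conn {p | p ∈ S i} x' 1 x) :
    ∃ S' : ∀ i, Multiset (ℕ × M i × ℕ), IsGraph S' (V.erase x') ∧
      (∀ g, Conn (arcs S) 0 g 0 → Conn (arcs S') 0 g 0) ∧
      ∑ i, (S' i).card + 1 = ∑ i, (S i).card := by
  classical
  obtain ⟨p, a, y, rfl, hyp, hs⟩ := hfold.exists_crossing (fun z => z = x') rfl hne.symm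
  obtain ⟨s, hs, hsS⟩ : ∃ s, (s = (p, a, y) ∨ s = (y, a⁻¹, p)) ∧ s ∈ S i := by
    rcases hs with hs | hs
    · exact ⟨_, Or.inl rfl, hs⟩
    · exact ⟨_, Or.inr rfl, hs⟩
  have hyV : y ∈ V := by
    rcases hs with rfl | rfl
    · exact h.right_mem hsS
    · exact h.left_mem hsS
  have hxV : x ∈ V := by
    refine (hfold.iff_of_arcs (P := (· ∈ V)) fun x a y hs => ?_).1 hV
    exact iff_of_true (h.left_mem hs) (h.right_mem hs)
  obtain ⟨R, hR⟩ := Multiset.exists_cons_of_mem hsS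
  obtain ⟨R', hcard, hmem, hconn⟩ := conn_contract (R := R) hyp hs
  let π : ℕ → ℕ := Function.update id p x
  have hπ {z : ℕ} (hz : z ≠ p) : π z = z := by simp [π, Function.update_of_ne hz]
  have hπp : π p = x := by simp [π]
  have hπV {z : ℕ} (hz : z ∈ V) : π z ∈ V.erase p := by
    by_cases hzp : z = p
    · subst hzp
      rw [hπp]
      exact Finset.mem_erase.2 ⟨hne.symm, hxV⟩
    · rw [hπ hzp]
      exact Finset.mem_erase.2 ⟨hzp, hz⟩
  have hπne (z : ℕ) : π z ≠ p := by
    by_cases hzp : z = p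
    · subst hzp
      rw [hπp]
      exact hne.symm
    · rwa [hπ hzp]
  have hπc (z : ℕ) : Conn {p | p ∈ S i} z 1 (π z) := by
    by_cases hzp : z = p
    · subst hzp
      rwa [hπp]
    · rw [hπ hzp]
      exact .refl z
  let S' : ∀ i, Multiset (ℕ × M i × ℕ) :=
    Function.update (fun k => (S k).map fun p => (π p.1, p.2.1, π p.2.2)) i R'
  have hSi : S' i = R' := by simp [S']
  have hSk {k : ι} (hk : k ≠ i) : S' k = (S k).map fun p => (π p.1, p.2.1, π p.2.2) := by
    simp [S', Function.update_of_ne hk]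
  have hpush {z w : ℕ} {g : CoprodI M} (hzw : Conn (arcs S) z g w) :
      Conn (arcs S') (π z) g (π w) := by
    refine hzw.map_hom π (MonoidHom.id _) ?_
    rintro z g w ⟨k, m, hm, rfl⟩
    refine conn_arcs ?_
    by_cases hk : k = i
    · subst hk
      rw [hSi]
      refine hconn _ _ _ (hπne z) (hπne w) ?_
      rw [← hR]
      exact (((hπc z).symm.trans (.of hm)).trans (hπc w)).of_eq (by simp)
    · rw [hSk hk]
      exact .of (Multiset.mem_map.2 ⟨_, hm, rfl⟩)
  have hmemV {k : ι} {q : ℕ × M k × ℕ} (hq : q ∈ S' k) :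
      q.1 ∈ V.erase p ∧ q.2.2 ∈ V.erase p := by
    by_cases hk : k = i
    · subst hk
      rw [hSi] at hq
      refine hmem V hyV (fun r hr => ?_) q hq
      have hrS : r ∈ S k := hR ▸ Multiset.mem_cons_of_mem hr
      exact ⟨h.left_mem hrS, h.right_mem hrS⟩
    · rw [hSk hk] at hq
      obtain ⟨r, hr, rfl⟩ := Multiset.mem_map.1 hq
      exact ⟨hπV (h.left_mem hr), hπV (h.right_mem hr)⟩
  refine ⟨S', ⟨Finset.mem_erase.2 ⟨hx'.symm, h.zero_mem⟩, fun hq => (hmemV hq).1,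
    fun hq => (hmemV hq).2, fun z hz => ?_⟩, fun g hg => ?_, ?_⟩
  · obtain ⟨hzp, hzV⟩ := Finset.mem_erase.1 hz
    obtain ⟨g, hg⟩ := h.conn z hzV
    refine ⟨g, ?_⟩
    have := hpush hg
    rwa [hπ hx'.symm, hπ hzp] at this
  · have := hpush hg
    rwa [hπ hx'.symm] at this
  · have hsplit (S : ∀ i, Multiset (ℕ × M i × ℕ)) :=
      (Finset.add_sum_erase Finset.univ (fun k => (S k).card) (Finset.mem_univ i)).symm
    rw [hsplit, hsplit S, hSi, hR, hcard, Finset.sum_congr rfl fun k hk => by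
      rw [hSk (Finset.ne_of_mem_erase hk), Multiset.card_map]]
    simp
    ring

section Reading

variable [∀ i, DecidableEq (M i)]

/-- A word can be read letter by letter along paths in the labelled graphs of the factors. -/
def Readable (S : ∀ i, Multiset (ℕ × M i × ℕ)) : ℕ → List (Σ i, M i) → ℕ → Prop
  | x, [], y => x = y
  | x, l :: w, y => ∃ z, Conn {p | p ∈ S l.1} x l.2 z ∧ Readable S z w y

/-- No path in the graph of one factor with distinct end points spells the identity. -/
def IsFolded (S : ∀ i, Multiset (ℕ × M i × ℕ)) : Prop :=
  ∀ i x y, Conn {p | p ∈ S i} x 1 y → x = y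

theorem readable_rcons {S : ∀ i, Multiset (ℕ × M i × ℕ)} (hS : IsFolded S) {i : ι}
    (p : CoprodI.Word.Pair M i) (x y : ℕ) :
    Readable S x (CoprodI.Word.rcons p).toList y ↔
      ∃ z, Conn {p | p ∈ S i} x p.head z ∧ Readable S z p.tail.toList y := by
  by_cases hp : p.head = 1
  · rw [CoprodI.Word.rcons, dif_pos hp, hp]
    constructor
    · exact fun h => ⟨x, .refl x, h⟩
    · rintro ⟨z, hz, h⟩
      rwa [hS i x z hz]
  · rw [CoprodI.Word.rcons, dif_neg hp]
    rfl

variable [DecidableEq ι]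

theorem Readable.smul_of {S : ∀ i, Multiset (ℕ × M i × ℕ)} (hS : IsFolded S) {i : ι} {m : M i}
    {x y z : ℕ} {w : CoprodI.Word M} (hxy : Conn {p | p ∈ S i} x m y)
    (h : Readable S y w.toList z) : Readable S x ((CoprodI.of m : CoprodI M) • w).toList z := by
  rw [CoprodI.Word.of_smul_def, readable_rcons hS]
  rw [← (CoprodI.Word.equivPair i).symm_apply_apply w, CoprodI.Word.equivPair_symm,
    readable_rcons hS] at h
  obtain ⟨v, hv, h⟩ := h
  exact ⟨v, hxy.trans hv, h⟩

theorem readable_smul_iff {S : ∀ i, Multiset (ℕ × M i × ℕ)} (hS : IsFolded S) {g : CoprodI M}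
    {x y : ℕ} (hxy : Conn (arcs S) x g y) (z : ℕ) (w : CoprodI.Word M) :
    Readable S y w.toList z ↔ Readable S x (g • w).toList z := by
  induction hxy generalizing w with
  | refl x => rw [one_smul]
  | of hs =>
    obtain ⟨i, m, hm, hg⟩ := hs
    dsimp only at hm hg
    subst hg
    refine ⟨fun h => h.smul_of hS (.of hm), fun h => ?_⟩
    have := h.smul_of hS (Conn.of (S := {p | p ∈ S i}) hm).symm
    rwa [map_inv, inv_smul_smul] at this
  | symm _ ih => rw [ih, smul_inv_smul]
  | trans _ _ ih1 ih2 => rw [ih2, ih1, mul_smul]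

/-- In a folded graph, a path that spells an element of a factor can be chosen in the graph of
that factor. -/
theorem IsFolded.conn {S : ∀ i, Multiset (ℕ × M i × ℕ)} (hS : IsFolded S) {i : ι} {m : M i}
    {x y : ℕ} (h : Conn (arcs S) x (CoprodI.of m) y) : Conn {p | p ∈ S i} x m y := by
  have h1 := (readable_smul_iff hS h y CoprodI.Word.empty).1 rfl
  rw [CoprodI.Word.of_smul_def, readable_rcons hS,
    CoprodI.Word.equivPair_eq_of_fstIdx_ne
      (by simp [CoprodI.Word.fstIdx, CoprodI.Word.empty])] at h1
  obtain ⟨z, hz, rfl⟩ := h1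
  simpa using hz

end Reading

theorem exists_folded [Fintype ι] (d : ℕ) (V : Finset ℕ) :
    ∀ (S : ∀ i, Multiset (ℕ × M i × ℕ)), IsGraph S V → (∀ g, Conn (arcs S) 0 g 0) →
    ∑ i, (S i).card + 1 ≤ d + V.card →
    ∃ (S : ∀ i, Multiset (ℕ × M i × ℕ)), IsGraph S {0} ∧ (∀ g, Conn (arcs S) 0 g 0) ∧
      IsFolded S ∧ ∑ i, (S i).card ≤ d := by
  classical
  induction V using Finset.strongInduction with
  | H V ih =>
    intro S h hconn hcard
    by_cases hS : IsFolded S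
    · have hV : V = {0} := by
        refine Finset.eq_singleton_iff_unique_mem.2 ⟨h.zero_mem, fun x hx => ?_⟩
        by_contra hx0
        obtain ⟨g, hg⟩ := h.conn x hx
        obtain ⟨p, b, y, rfl, hy, hpy⟩ := hg.exists_crossing (fun z => z = 0) rfl hx0
        obtain ⟨i, m, hm⟩ : ∃ i, ∃ m : M i, Conn {p | p ∈ S i} 0 m y := by
          rcases hpy with ⟨i, m, hm, -⟩ | ⟨i, m, hm, -⟩
          · exact ⟨i, m, .of hm⟩
          · exact ⟨i, m⁻¹, Conn.symm (.of hm)⟩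
        have h1 := (hS.conn (hconn (CoprodI.of m⁻¹))).trans hm
        rw [inv_mul_cancel] at h1
        exact hy (hS i 0 y h1).symm
      subst hV
      exact ⟨S, h, hconn, hS, by simpa using hcard⟩
    · simp only [IsFolded, not_forall] at hS
      obtain ⟨i, x, x', hxx', hne⟩ := hS
      obtain ⟨x, x', hx', hne, hxx'⟩ :
          ∃ x x' : ℕ, x' ≠ 0 ∧ x' ≠ x ∧ Conn {p | p ∈ S i} x' 1 x := by
        by_cases hx0 : x = 0
        · exact ⟨x, x', fun h => hne (hx0.trans h.symm), Ne.symm hne,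
            hxx'.symm.of_eq inv_one⟩
        · exact ⟨x', x, hx0, hne, hxx'⟩
      have hV : x' ∈ V := by
        obtain ⟨p, b, q, rfl, -, hpq | hpq⟩ :=
          hxx'.exists_crossing (fun z => z = x') rfl hne.symm
        · exact h.left_mem hpq
        · exact h.right_mem hpq
      obtain ⟨S', hS', hconn', hcard'⟩ := fold h hx' hne hV hxx'
      have := Finset.card_erase_add_one hV
      exact ih _ (Finset.erase_ssubset hV) S' hS' (fun g => hconn' g (hconn g)) (by omega)

end Grushko

/-- **Grushko's theorem**: the rank of a free product is at least the sum of the ranks of its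
factors. -/
theorem Monoid.CoprodI.exists_generators {ι : Type*} [Fintype ι] {M : ι → Type*}
    [∀ i, Group (M i)] (s : Finset (CoprodI M)) (hs : Subgroup.closure (s : Set (CoprodI M)) = ⊤) :
    ∃ T : ∀ i, Finset (M i), (∀ i, Subgroup.closure (T i : Set (M i)) = ⊤) ∧
      ∑ i, (T i).card ≤ s.card := by
  classical
  rcases isEmpty_or_nonempty ι with hι | hι
  · exact ⟨isEmptyElim, isEmptyElim, by simp⟩
  obtain ⟨S, V, h, hconn, hcard⟩ := Grushko.exists_graph s
  have hconn' (g : CoprodI M) : Conn (Grushko.arcs S) 0 g 0 := by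
    have hg : g ∈ Subgroup.closure (s : Set (CoprodI M)) := hs ▸ Subgroup.mem_top g
    induction hg using Subgroup.closure_induction with
    | mem g hg => exact hconn g hg
    | one => exact .refl 0
    | mul _ _ _ _ h1 h2 => exact h1.trans h2
    | inv _ _ h => exact h.symm
  obtain ⟨S, h, hconn, hS, hcard⟩ := Grushko.exists_folded s.card V S h hconn' hcard
  refine ⟨fun i => (S i).toFinset.image fun p => p.2.1, fun i => ?_, ?_⟩
  · refine top_le_iff.1 fun m _ => ?_
    have key {x y : ℕ} {m : M i} (hxy : Conn {p | p ∈ S i} x m y) :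
        m ∈ Subgroup.closure
          ((((S i).toFinset.image fun p => p.2.1 : Finset (M i))) : Set (M i)) := by
      induction hxy with
      | refl x => exact one_mem _
      | @of x m y hm =>
        refine Subgroup.subset_closure ?_
        simp only [Finset.coe_image, Set.mem_image, Finset.mem_coe, Multiset.mem_toFinset]
        exact ⟨_, hm, rfl⟩
      | symm _ ih => exact inv_mem ih
      | trans _ _ ih1 ih2 => exact mul_mem ih1 ih2
    exact key (hS.conn (hconn (CoprodI.of m)))
  · refine le_trans (Finset.sum_le_sum fun i _ => ?_) hcard
    exact Finset.card_image_le.trans (Multiset.toFinset_card_le _)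

/-- Breadth-first search: every vertex reachable from `v₀` has a predecessor of smaller depth. -/
theorem exists_depth {V : Type*} (r : V → V → Prop) (v₀ : V) :
    ∃ d : V → ℕ, ∀ v, Relation.ReflTransGen r v₀ v → v ≠ v₀ →
      ∃ u, Relation.ReflTransGen r v₀ u ∧ r u v ∧ d u < d v := by
  classical
  let L : ℕ → Set V := Nat.rec {v₀} fun _ A => {v | ∃ u ∈ A, r u v}
  have hL (n : ℕ) : ∀ v ∈ L n, Relation.ReflTransGen r v₀ v := by
    induction n with
    | zero =>
      intro v hv
      rw [show v = v₀ from hv]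
    | succ n ih =>
      rintro v ⟨u, hu, huv⟩
      exact (ih u hu).tail huv
  have hex (v : V) (hv : Relation.ReflTransGen r v₀ v) : ∃ n, v ∈ L n := by
    induction hv with
    | refl => exact ⟨0, rfl⟩
    | @tail u v _ huv ih =>
      obtain ⟨n, hn⟩ := ih
      exact ⟨n + 1, u, hn, huv⟩
  refine ⟨fun v => sInf {n | v ∈ L n}, fun v hv hne => ?_⟩
  have hmem : sInf {n | v ∈ L n} ∈ {n | v ∈ L n} := Nat.sInf_mem (hex v hv)
  generalize hn : sInf {n | v ∈ L n} = n at hmem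
  cases n with
  | zero => exact absurd hmem hne
  | succ n =>
    obtain ⟨u, hu, huv⟩ := hmem
    refine ⟨u, hL n u hu, huv, ?_⟩
    dsimp only
    rw [hn]
    exact Nat.lt_succ_of_le (Nat.sInf_le hu)

/-- A cocycle on a free product can be prescribed freely on the factors. -/
theorem IsFreeDecomposition.exists_cocycle {G ι X K : Type*} [Group G] [Group K] [MulAction G X]
    {S : ι → Subgroup G} (hS : IsFreeDecomposition S) (α : ∀ i, S i → X → K)
    (hα : ∀ i (s s' : S i) x, α i (s * s') x = α i s (s' • x) * α i s' x) :
    ∃ A : G → X → K, (∀ g g' x, A (g * g') x = A g (g' • x) * A g' x) ∧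
      ∀ i (s : S i) x, A s x = α i s x := by
  have hα1 (i : ι) (x : X) : α i 1 x = 1 := by simpa using hα i 1 1 x
  let f (i : ι) : S i →* Equiv.Perm (X × K) := MonoidHom.toHomPerm
    { toFun := fun s => fun p : X × K => (s • p.1, α i s p.1 * p.2)
      map_one' := by
        funext p
        simp only [hα1, one_smul, one_mul]
        rfl
      map_mul' := fun s s' => by
        funext p
        simp only [hα, mul_smul, mul_assoc]
        rfl }
  obtain ⟨F, hF⟩ := hS.exists_extend f
  have hf (i : ι) (s : S i) (p : X × K) : F s p = ((s : G) • p.1, α i s p.1 * p.2) := by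
    rw [hF]
    rfl
  have key (g : G) : ∀ x k, F g (x, k) = (g • x, (F g (x, 1)).2 * k) := by
    have hg : g ∈ ⨆ i, S i := hS.iSup_eq_top ▸ Subgroup.mem_top g
    induction hg using Subgroup.iSup_induction' with
    | hp i s hs =>
      intro x k
      have h (k : K) := hf i ⟨s, hs⟩ (x, k)
      simp only at h
      rw [h, h]
      simp
    | h1 => simp
    | hmul g g' _ _ h h' =>
      intro x k
      rw [map_mul, Equiv.Perm.mul_apply, Equiv.Perm.mul_apply, h', h, h' x 1, h _ (_ * 1), mul_smul]
      simp [mul_assoc]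
  refine ⟨fun g x => (F g (x, 1)).2, fun g g' x => ?_, fun i s x => ?_⟩
  · change (F (g * g') (x, 1)).2 = _
    rw [map_mul, Equiv.Perm.mul_apply, key g' x 1, key g]
    simp
  · change (F s (x, 1)).2 = _
    rw [hf]
    simp

namespace Kurosh

/-- A maximal tree in the graph whose vertices are the points of a `G`-set and the orbits of the
factors of a free decomposition of `G`. The point `t i x • x` is the base point of the orbit of `x`
under the factor `i`, and `θ x` describes the path in the tree from the base point `x₀` to `x`. -/
structure Tree {G ι X : Type*} [Group G] [MulAction G X] (S : ι → Subgroup G) (x₀ : X) where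
  /-- moves a point to the base point of its orbit -/
  t : ∀ i, X → S i
  /-- the edges of the tree -/
  tree : Set (ι × X)
  /-- moves `x₀` to a point along the tree -/
  θ : X → G
  /-- the distance from `x₀` -/
  depth : X → ℕ
  smul_base : ∀ i (s : S i) x, t i (s • x) • s • x = t i x • x
  t_base : ∀ i x, t i (t i x • x) = 1
  mem_base : ∀ i x, (i, t i x • x) ∈ tree
  θ_smul : ∀ x, θ x • x₀ = x
  θ_base : θ x₀ = 1
  θ_tree : ∀ i x, (i, x) ∈ tree → θ x = (t i x : G)⁻¹ * θ (t i x • x)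
  exists_parent : ∀ x, x ≠ x₀ → ∃ i, (i, x) ∈ tree ∧ depth (t i x • x) < depth x

theorem exists_tree {G ι X : Type*} [Group G] [MulAction G X] [MulAction.IsPretransitive G X]
    {S : ι → Subgroup G} (htop : ⨆ i, S i = ⊤) (x₀ : X) : Nonempty (Tree S x₀) := by
  classical
  obtain ⟨d, hd⟩ := exists_depth (fun x y : X => ∃ i, ∃ s : S i, s • x = y) x₀
  have hreach (g : G) (x : X) :
      Relation.ReflTransGen (fun x y : X => ∃ i, ∃ s : S i, s • x = y) x (g • x) := by
    have hg : g ∈ ⨆ i, S i := htop ▸ Subgroup.mem_top g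
    induction hg using Subgroup.iSup_induction' generalizing x with
    | hp i s hs => exact .single ⟨i, ⟨s, hs⟩, rfl⟩
    | h1 =>
      rw [one_smul]
    | hmul g g' _ _ h h' =>
      rw [mul_smul]
      exact (h' x).trans (h _)
  have hmin (i : ι) (o : MulAction.orbitRel.Quotient (S i) X) :
      ∃ b : X, (⟦b⟧ : MulAction.orbitRel.Quotient (S i) X) = o ∧
        ∀ y : X, (⟦y⟧ : MulAction.orbitRel.Quotient (S i) X) = o → d b ≤ d y := by
    obtain ⟨y, hy⟩ := Quotient.exists_rep o
    have hne : {y : X | (⟦y⟧ : MulAction.orbitRel.Quotient (S i) X) = o}.Nonempty := ⟨y, hy⟩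
    exact ⟨_, Function.argminOn_mem d _ hne, fun y hy => Function.argminOn_le d _ hy⟩
  choose B hB hBmin using hmin
  have ht (i : ι) (x : X) : ∃ s : S i, s • x = B i ⟦x⟧ ∧ (x = B i ⟦x⟧ → s = 1) := by
    by_cases hx : x = B i ⟦x⟧
    · exact ⟨1, by rw [one_smul]; exact hx, fun _ => rfl⟩
    · obtain ⟨s, hs⟩ := Quotient.exact (hB i ⟦x⟧)
      exact ⟨s, hs, fun h => absurd h hx⟩
  choose t htB ht1 using ht
  have hBB (i : ι) (s : S i) (x : X) : B i ⟦s • x⟧ = B i ⟦x⟧ :=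
    congrArg (B i) (Quotient.sound ⟨s, rfl⟩)
  have hpar (x : X) (hx : x ≠ x₀) : ∃ i, d (t i x • x) < d x := by
    obtain ⟨g, hg⟩ := MulAction.exists_smul_eq G x₀ x
    obtain ⟨u, -, ⟨i, s, hs⟩, hlt⟩ := hd x (hg ▸ hreach g x₀) hx
    refine ⟨i, lt_of_le_of_lt ?_ hlt⟩
    rw [htB, ← hs, hBB]
    exact hBmin i _ u rfl
  choose k hk using hpar
  let θ : X → G := (measure d).wf.fix fun x rec =>
    if hx : x = x₀ then 1 else (t (k x hx) x : G)⁻¹ * rec (t (k x hx) x • x) (hk x hx)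
  have hθ (x : X) : θ x =
      if hx : x = x₀ then 1 else (t (k x hx) x : G)⁻¹ * θ (t (k x hx) x • x) :=
    WellFounded.fix_eq _ _ x
  have hbase (i : ι) (x : X) : t i (t i x • x) = 1 := by
    refine ht1 i _ ?_
    rw [hBB, htB]
  refine ⟨⟨t, {p | t p.1 p.2 • p.2 = p.2 ∨ ∃ hx : p.2 ≠ x₀, p.1 = k p.2 hx}, θ, d,
    fun i s x => ?_, hbase, fun i x => Or.inl ?_, fun x => ?_, ?_, fun i x hx => ?_,
    fun x hx => ?_⟩⟩
  · rw [htB, htB, hBB]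
  · rw [hbase, one_smul]
  · induction h : d x using Nat.strong_induction_on generalizing x with
    | _ n ih =>
      rw [hθ]
      split_ifs with hx
      · rw [one_smul, hx]
      · rw [mul_smul, ih _ (h ▸ hk x hx) _ rfl]
        exact inv_smul_smul (t (k x hx) x : G) x
  · rw [hθ, dif_pos rfl]
  · rcases hx with hx | ⟨hx, hi⟩
    · have h1 : t i x = 1 := by
        have := hbase i x
        rwa [hx] at this
      simp [h1]
    · dsimp only at hx hi
      subst hi
      rw [hθ x, dif_neg hx]
  · exact ⟨k x hx, Or.inr ⟨hx, rfl⟩, hk x hx⟩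

namespace Tree

variable {G ι X : Type*} [Group G] [MulAction G X] {S : ι → Subgroup G} {x₀ : X} (D : Tree S x₀)

/-- The generator of the stabilizer of the base point that corresponds to an edge. -/
def z (i : ι) (x : X) : G := (D.θ (D.t i x • x))⁻¹ * D.t i x * D.θ x

theorem z_smul (i : ι) (x : X) : D.z i x • x₀ = x₀ := by
  rw [z, mul_smul, mul_smul, D.θ_smul, inv_smul_eq_iff, D.θ_smul]
  rfl

theorem smul_base_self (i : ι) (s : S i) (x : X) :
    (D.t i (s • x) * s * (D.t i x)⁻¹) • D.t i x • x = D.t i x • x := by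
  rw [mul_smul, mul_smul, inv_smul_smul, D.smul_base]

theorem exists_hom (hS : IsFreeDecomposition S) {K : Type*} [Group K] (p : ∀ i, X → S i → K)
    (hp : ∀ i b (s s' : S i), s • b = b → s' • b = b → p i b (s * s') = p i b s * p i b s')
    (γ : ι → X → K) (hγ : ∀ i x, (i, x) ∈ D.tree → γ i x = 1) :
    ∃ Ψ : MulAction.stabilizer G x₀ →* K,
      (∀ i b (s : S i) (h : MulAction.stabilizer G x₀), D.t i b • b = b → s • b = b →
        (h : G) = (D.θ b)⁻¹ * s * D.θ b → Ψ h = p i b s) ∧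
      ∀ i x (h : MulAction.stabilizer G x₀), (h : G) = D.z i x → Ψ h = γ i x := by
  have hp1 (i : ι) (b : X) : p i b 1 = 1 := by
    simpa using hp i b 1 1 (one_smul _ b) (one_smul _ b)
  obtain ⟨A, hA, hAα⟩ := hS.exists_cocycle (X := X) (fun i s x => (γ i (s • x))⁻¹ *
    p i (D.t i x • x) (D.t i (s • x) * s * (D.t i x)⁻¹) * γ i x) (fun i s s' x => by
      have h1 := D.smul_base_self i s (s' • x)
      rw [D.smul_base i s' x] at h1
      have h2 := hp i (D.t i x • x) _ _ h1 (D.smul_base_self i s' x)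
      rw [D.smul_base i s' x, mul_smul, show D.t i (s • s' • x) * (s * s') * (D.t i x)⁻¹ =
        D.t i (s • s' • x) * s * (D.t i (s' • x))⁻¹ * (D.t i (s' • x) * s' * (D.t i x)⁻¹) by group,
        h2]
      group)
  have hA1 (x : X) : A 1 x = 1 := by simpa using hA 1 1 x
  have hAinv (g : G) (x : X) : A g⁻¹ (g • x) = (A g x)⁻¹ := by
    rw [eq_inv_iff_mul_eq_one, ← hA, inv_mul_cancel, hA1]
  have hAt (i : ι) (x : X) : A (D.t i x : G) x = γ i x := by
    rw [hAα, D.t_base, hγ i _ (D.mem_base i x)]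
    simp [hp1]
  have hAθ (x : X) : A (D.θ x) x₀ = 1 := by
    induction h : D.depth x using Nat.strong_induction_on generalizing x with
    | _ n ih =>
      by_cases hx : x = x₀
      · rw [hx, D.θ_base, hA1]
      · obtain ⟨i, hi, hlt⟩ := D.exists_parent x hx
        have h1 := hAinv (D.t i x : G) x
        rw [hAt, hγ i x hi, inv_one] at h1
        rw [D.θ_tree i x hi, hA, ih _ (h ▸ hlt) _ rfl, D.θ_smul, mul_one]
        exact h1
  have hAθ' (x : X) : A (D.θ x)⁻¹ x = 1 := by
    have := hAinv (D.θ x) x₀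
    rwa [D.θ_smul, hAθ, inv_one] at this
  let Ψ : MulAction.stabilizer G x₀ →* K :=
    { toFun := fun h => A h x₀
      map_one' := hA1 x₀
      map_mul' := fun h h' => by
        rw [Subgroup.coe_mul, hA, show (h' : G) • x₀ = x₀ from h'.2] }
  refine ⟨Ψ, fun i b s h hb hs hh => ?_, fun i x h hh => ?_⟩
  · change A h x₀ = _
    have hb1 : D.t i b = 1 := by
      have := D.t_base i b
      rwa [hb] at this
    have hγb : γ i b = 1 := hγ i b (by simpa [hb] using D.mem_base i b)
    rw [hh, hA, hA, D.θ_smul, hAθ, hAα, show (s : G) • b = b from hs, hAθ']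
    simp [hs, hb1, hγb]
  · change A h x₀ = _
    rw [hh, z, hA, hA, D.θ_smul, hAθ, hAt, show (D.t i x : G) • x = D.t i x • x from rfl, hAθ']
    simp

/-- The factors of the stabilizer of the base point. -/
def factor : {c : ι × X // D.t c.1 c.2 • c.2 = c.2} ⊕ (ι × X) → Subgroup (MulAction.stabilizer G x₀)
  | .inl c => (S c.1.1).comap
      ((MulAut.conj (D.θ c.1.2)).toMonoidHom.comp (MulAction.stabilizer G x₀).subtype)
  | .inr e => Subgroup.zpowers ⟨D.z e.1 e.2, D.z_smul e.1 e.2⟩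

theorem exists_mem_factor {i : ι} {b : X} (hb : D.t i b • b = b) (s : S i) (hs : s • b = b) :
    ∃ h : D.factor (.inl ⟨(i, b), hb⟩), ((h : MulAction.stabilizer G x₀) : G) =
      (D.θ b)⁻¹ * s * D.θ b := by
  refine ⟨⟨⟨(D.θ b)⁻¹ * s * D.θ b, ?_⟩, ?_⟩, rfl⟩
  · rw [MulAction.mem_stabilizer_iff, mul_smul, mul_smul, D.θ_smul, inv_smul_eq_iff, D.θ_smul]
    exact hs
  · change D.θ b * ((D.θ b)⁻¹ * s * D.θ b) * (D.θ b)⁻¹ ∈ S i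
    simp [mul_assoc]

theorem iSup_factor (htop : ⨆ i, S i = ⊤) : ⨆ c, D.factor c = ⊤ := by
  have hinr (i : ι) (x : X) : D.z i x ∈ (⨆ c, D.factor c).map (MulAction.stabilizer G x₀).subtype :=
    ⟨⟨D.z i x, D.z_smul i x⟩, Subgroup.mem_iSup_of_mem (Sum.inr (i, x))
      (Subgroup.mem_zpowers _), rfl⟩
  have key (g : G) : ∀ x, (D.θ (g • x))⁻¹ * g * D.θ x ∈
      (⨆ c, D.factor c).map (MulAction.stabilizer G x₀).subtype := by
    have hg : g ∈ ⨆ i, S i := htop ▸ Subgroup.mem_top g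
    induction hg using Subgroup.iSup_induction' with
    | hp i s hs =>
      intro x
      set s' : S i := ⟨s, hs⟩
      have hb := D.smul_base_self i s' x
      have hc : (D.θ (D.t i x • x))⁻¹ * (D.t i (s' • x) * s' * (D.t i x)⁻¹ : S i) *
          D.θ (D.t i x • x) ∈ (⨆ c, D.factor c).map (MulAction.stabilizer G x₀).subtype := by
        obtain ⟨h, hh⟩ := D.exists_mem_factor (by rw [D.t_base, one_smul]) _ hb
        exact ⟨h, Subgroup.mem_iSup_of_mem _ h.2, hh⟩
      have := mul_mem (mul_mem (inv_mem (hinr i (s' • x))) hc) (hinr i x)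
      rw [z, z, D.smul_base i s' x] at this
      convert this using 1
      change (D.θ (s' • x))⁻¹ * _ * _ = _
      simp [mul_assoc, s']
    | h1 => simp [one_mem]
    | hmul g g' _ _ h h' =>
      intro x
      have := mul_mem (h (g' • x)) (h' x)
      convert this using 1
      simp [mul_assoc, mul_smul]
  refine top_le_iff.1 fun h _ => ?_
  have := key h x₀
  rw [show (h : G) • x₀ = x₀ from h.2, D.θ_base] at this
  obtain ⟨h', hh', heq⟩ := this
  obtain rfl : h' = h := Subtype.ext (by simpa using heq)
  exact hh'

theorem isFreeDecomposition_factor (hS : IsFreeDecomposition S) :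
    IsFreeDecomposition D.factor := by
  classical
  choose m hm using fun i b (hb : D.t i b • b = b) => D.exists_mem_factor hb
  have hz (i : ι) (x : X) (hx : (i, x) ∈ D.tree) : D.z i x = 1 := by
    rw [z, D.θ_tree i x hx]
    simp
  obtain ⟨Ψ, hΨ1, hΨ2⟩ := D.exists_hom hS (K := CoprodI fun c => D.factor c)
    (fun i b s => if h : D.t i b • b = b ∧ s • b = b then ofFactor D.factor _ (m i b h.1 s h.2)
      else 1)
    (fun i b s s' hs hs' => by
      by_cases hb : D.t i b • b = b
      · have hss : (s * s') • b = b := by rw [mul_smul, hs', hs]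
        rw [dif_pos ⟨hb, hss⟩, dif_pos ⟨hb, hs⟩, dif_pos ⟨hb, hs'⟩, ← map_mul]
        congr 1
        apply Subtype.ext
        apply Subtype.ext
        simp [hm, mul_assoc]
      · simp [hb])
    (fun i x => ofFactor D.factor (.inr (i, x))
      ⟨⟨D.z i x, D.z_smul i x⟩, Subgroup.mem_zpowers _⟩)
    (fun i x hx => by
      rw [← map_one (ofFactor D.factor (.inr (i, x)))]
      congr 1
      apply Subtype.ext
      apply Subtype.ext
      exact hz i x hx)
  refine .of_extend (D.iSup_factor hS.iSup_eq_top) Ψ ?_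
  rintro (⟨⟨i, b⟩, hb⟩ | ⟨i, x⟩) ⟨h, hh⟩
  · have hs : D.θ b * h * (D.θ b)⁻¹ ∈ S i := hh
    have hsb : (⟨_, hs⟩ : S i) • b = b := by
      change (D.θ b * h * (D.θ b)⁻¹) • b = b
      rw [mul_smul, mul_smul, show (D.θ b)⁻¹ • b = x₀ by rw [inv_smul_eq_iff, D.θ_smul],
        show (h : G) • x₀ = x₀ from h.2, D.θ_smul]
    have := hΨ1 i b ⟨_, hs⟩ h hb hsb (by simp [mul_assoc])
    rw [this, dif_pos ⟨hb, hsb⟩]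
    congr 1
    apply Subtype.ext
    apply Subtype.ext
    simp [hm, mul_assoc]
  · obtain ⟨n, rfl⟩ := hh
    have := hΨ2 i x ⟨D.z i x, D.z_smul i x⟩ rfl
    simp only [map_zpow, this]
    rw [← map_zpow]
    rfl

theorem z_zpow_ne_one (hS : IsFreeDecomposition S) {i : ι} {x : X} (hx : (i, x) ∉ D.tree) {n : ℤ}
    (hn : n ≠ 0) : D.z i x ^ n ≠ 1 := by
  classical
  obtain ⟨Ψ, -, hΨ⟩ := D.exists_hom hS (K := Multiplicative ℤ) (fun _ _ _ => 1)
    (fun _ _ _ _ _ _ => by simp)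
    (fun j y => if (j, y) ∈ D.tree then 1 else Multiplicative.ofAdd 1)
    (fun i x hx => by simp [hx])
  intro h
  have h1 := hΨ i x ⟨D.z i x, D.z_smul i x⟩ rfl
  rw [if_neg hx] at h1
  have h2 : (⟨D.z i x, D.z_smul i x⟩ : MulAction.stabilizer G x₀) ^ n = 1 := Subtype.ext h
  have h3 := congrArg Ψ h2
  rw [map_zpow, h1, Ψ.map_one] at h3
  have h4 := congrArg Multiplicative.toAdd h3
  rw [toAdd_zpow] at h4
  exact hn (by simpa using h4)

end Tree

end Kurosh

/-- The **Kurosh subgroup theorem**. -/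
theorem IsFreeDecomposition.exists_kurosh.{u} {G K ι : Type u} [Group G] [Group K]
    {S : ι → Subgroup G} (hS : IsFreeDecomposition S) (f : K →* G) (hf : Function.Injective f) :
    ∃ (Λ : Type u) (T : Λ → Subgroup K), IsFreeDecomposition T ∧
      ∀ c, (∃ g i, ∀ k ∈ T c, g * f k * g⁻¹ ∈ S i) ∨
        ∃ z, T c = Subgroup.zpowers z ∧ ∀ n : ℤ, z ^ n = 1 → n = 0 := by
  let x₀ : G ⧸ f.range := ((1 : G) : G ⧸ f.range)
  obtain ⟨D⟩ := Kurosh.exists_tree (X := G ⧸ f.range) hS.iSup_eq_top x₀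
  have hstab (h : G) : h ∈ MulAction.stabilizer G x₀ ↔ h ∈ f.range := by
    rw [MulAction.stabilizer_quotient]
  let e : K ≃* MulAction.stabilizer G x₀ := (MonoidHom.ofInjective hf).trans
    (MulEquiv.subgroupCongr (Subgroup.ext fun h => (hstab h).symm))
  have he (k : K) : (e k : G) = f k := rfl
  refine ⟨_, _, (D.isFreeDecomposition_factor hS).map_equiv e.symm, ?_⟩
  have hmem {c} {k : K} (hk : k ∈ (D.factor c).map e.symm.toMonoidHom) : e k ∈ D.factor c := by
    obtain ⟨h, hh, rfl⟩ := hk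
    simpa using hh
  rintro (⟨⟨i, b⟩, hb⟩ | ⟨i, x⟩)
  · exact Or.inl ⟨D.θ b, i, fun k hk => hmem hk⟩
  · by_cases hx : (i, x) ∈ D.tree
    · refine Or.inl ⟨1, i, fun k hk => ?_⟩
      have hz : D.z i x = 1 := by
        rw [Kurosh.Tree.z, D.θ_tree i x hx]
        simp
      obtain ⟨n, hn⟩ := hmem hk
      have h1 : f k = D.z i x ^ n := (congrArg Subtype.val hn).symm
      simp [h1, hz, one_mem]
    · refine Or.inr ⟨e.symm ⟨D.z i x, D.z_smul i x⟩, ?_, fun n hn => ?_⟩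
      · simp only [Kurosh.Tree.factor]
        exact MonoidHom.map_zpowers _ _
      · by_contra hne
        refine D.z_zpow_ne_one hS hx hne ?_
        rw [← map_zpow, EmbeddingLike.map_eq_one_iff] at hn
        exact congrArg Subtype.val hn

/-- Every automorphism has a finitely generated fixed subgroup. -/
def HasFGFixed (G : Type*) [Group G] : Prop :=
  ∀ φ : G ≃* G, Group.FG (fixedSubgroup (φ : G →* G))

/-- A nontrivial group that is not a free product of two nontrivial subgroups. -/
def IsIndecomposable (G : Type*) [Group G] : Prop :=
  Nontrivial G ∧ ∀ T : Bool → Subgroup G, IsFreeDecomposition T → T true = ⊥ ∨ T false = ⊥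

theorem mem_fixedSubgroup {G : Type*} [Group G] {φ : G →* G} {g : G} :
    g ∈ fixedSubgroup φ ↔ φ g = g :=
  Iff.rfl

theorem Group.FG.fixedSubgroup_of_semiconj {G H : Type*} [Group G] [Group H] {Φ : G →* G}
    {φ : H →* H} (hΦ : Group.FG (fixedSubgroup Φ)) (r : G →* H) (i : H →* G)
    (hri : ∀ h, r (i h) = h) (hr : ∀ g, r (Φ g) = φ (r g)) (hi : ∀ h, φ h = h → Φ (i h) = i h) :
    Group.FG (fixedSubgroup φ) := by
  refine Group.fg_of_surjective (f := (r.comp (fixedSubgroup Φ).subtype).codRestrict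
    (fixedSubgroup φ) fun g => ?_) fun h => ?_
  · rw [mem_fixedSubgroup]
    change φ (r g) = r g
    rw [← hr, show Φ g = g from g.2]
  · exact ⟨⟨i h, hi h h.2⟩, Subtype.ext (hri h)⟩

theorem HasFGFixed.of_equiv {G H : Type*} [Group G] [Group H] (h : HasFGFixed G) (e : G ≃* H) :
    HasFGFixed H := fun φ =>
  (h ((e.trans φ).trans e.symm)).fixedSubgroup_of_semiconj e.toMonoidHom e.symm.toMonoidHom
    (by simp) (by simp) (fun h hh => by simpa using hh)

theorem IsIndecomposable.of_equiv {G H : Type*} [Group G] [Group H] (h : IsIndecomposable G)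
    (e : G ≃* H) : IsIndecomposable H := by
  refine ⟨have := h.1; e.symm.toEquiv.nontrivial, fun T hT => ?_⟩
  have := h.2 _ (hT.map_equiv e.symm)
  rwa [Subgroup.map_eq_bot_iff_of_injective _ e.symm.injective,
    Subgroup.map_eq_bot_iff_of_injective _ e.symm.injective] at this

namespace IsFreeDecomposition

variable {G ι : Type*} [Group G] {S : ι → Subgroup G}

theorem exists_retraction (hS : IsFreeDecomposition S) (i : ι) :
    ∃ r : G →* S i, (∀ s : S i, r s = s) ∧ ∀ j ≠ i, ∀ s ∈ S j, r s = 1 := by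
  classical
  obtain ⟨r, hr⟩ := hS.exists_extend (K := S i)
    (fun j => if h : j = i then h ▸ MonoidHom.id (S j) else 1)
  refine ⟨r, fun s => ?_, fun j hj s hs => ?_⟩
  · simpa using hr i s
  · simpa [hj] using hr j ⟨s, hs⟩

/-- Automorphisms of a free factor extend to the whole group. -/
theorem exists_extend_equiv (hS : IsFreeDecomposition S) {i : ι} (α : S i ≃* S i) :
    ∃ Φ : G ≃* G, (∀ s : S i, Φ s = α s) ∧ ∀ j ≠ i, ∀ s ∈ S j, Φ s = s := by
  classical
  have hex (α : S i ≃* S i) :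
      ∃ Φ : G →* G, (∀ s : S i, Φ s = α s) ∧ ∀ j ≠ i, ∀ s ∈ S j, Φ s = s := by
    obtain ⟨Φ, hΦ⟩ := hS.exists_extend (K := G)
      (fun j => if h : j = i then
        (S i).subtype.comp (α.toMonoidHom.comp (h ▸ MonoidHom.id (S j))) else (S j).subtype)
    refine ⟨Φ, fun s => ?_, fun j hj s hs => ?_⟩
    · simpa using hΦ i s
    · simpa [hj] using hΦ j ⟨s, hs⟩
  have hid {α β : S i ≃* S i} (hαβ : ∀ s, β (α s) = s) {Φ Ψ : G →* G} (hΦ : ∀ s : S i, Φ s = α s)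
      (hΨ : ∀ s : S i, Ψ s = β s) (hΦ' : ∀ j ≠ i, ∀ s ∈ S j, Φ s = s)
      (hΨ' : ∀ j ≠ i, ∀ s ∈ S j, Ψ s = s) : Ψ.comp Φ = MonoidHom.id G := by
    refine hS.hom_ext fun j s hs => ?_
    by_cases hj : j = i
    · subst hj
      have := hΦ ⟨s, hs⟩
      simp only at this
      simp [this, hΨ, hαβ]
    · simp [hΦ' j hj s hs, hΨ' j hj s hs]
  obtain ⟨Φ, h1, h2⟩ := hex α
  obtain ⟨Ψ, h3, h4⟩ := hex α.symm
  exact ⟨Φ.toMulEquiv Ψ (hid (by simp) h1 h3 h2 h4) (hid (by simp) h3 h1 h4 h2), h1, h2⟩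

theorem hasFGFixed_factor (hS : IsFreeDecomposition S) (h : HasFGFixed G) (i : ι) :
    HasFGFixed (S i) := by
  intro α
  obtain ⟨r, hr, hr'⟩ := hS.exists_retraction i
  obtain ⟨Φ, hΦ, hΦ'⟩ := hS.exists_extend_equiv α
  have hrΦ : r.comp Φ.toMonoidHom = α.toMonoidHom.comp r := by
    refine hS.hom_ext fun j s hs => ?_
    by_cases hj : j = i
    · subst hj
      have h1 := hΦ ⟨s, hs⟩
      have h2 := hr ⟨s, hs⟩
      simp only at h1 h2
      simp [h1, h2, hr]
    · simp [hΦ' j hj s hs, hr' j hj s hs]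
  exact (h Φ).fixedSubgroup_of_semiconj r (S i).subtype hr (DFunLike.congr_fun hrΦ) fun s hs => by
    simpa [hΦ] using hs

theorem of_isEmpty [Subsingleton G] [IsEmpty ι] : IsFreeDecomposition S :=
  of_extend (Subsingleton.elim _ _) 1 isEmptyElim

theorem of_unique [Unique ι] (h : S default = ⊤) : IsFreeDecomposition S := by
  obtain rfl : S = fun _ => ⊤ := by
    funext i
    rw [Unique.eq_default i, h]
  refine of_extend iSup_const ((ofFactor _ default).comp Subgroup.topEquiv.symm.toMonoidHom) ?_
  intro i s
  obtain rfl := Unique.eq_default i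
  rfl

theorem exists_ne_bot [Nontrivial G] (hS : IsFreeDecomposition S) : ∃ i, S i ≠ ⊥ := by
  by_contra! h
  have := hS.iSup_eq_top
  simp [h] at this

end IsFreeDecomposition

/-- An indecomposable subgroup of a free product is infinite cyclic or conjugate into a factor. -/
theorem IsIndecomposable.conj_or_cyclic.{u} {G K ι : Type u} [Group G] [Group K]
    {S : ι → Subgroup G} (hS : IsFreeDecomposition S) (hK : IsIndecomposable K) (f : K →* G)
    (hf : Function.Injective f) :
    (∃ g i, ∀ k, g * f k * g⁻¹ ∈ S i) ∨
      ∃ z : K, Subgroup.zpowers z = ⊤ ∧ ∀ n : ℤ, z ^ n = 1 → n = 0 := by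
  obtain ⟨Λ, T, hT, h⟩ := hS.exists_kurosh f hf
  have := hK.1
  obtain ⟨c, hc⟩ := hT.exists_ne_bot
  have hbool := hT.bool c
  have hc' : T c = ⊤ := by
    rcases hK.2 _ hbool with h0 | h0
    · exact absurd h0 (by simpa using hc)
    · have := hbool.iSup_eq_top
      rw [iSup_bool_eq, h0] at this
      simpa using this
  rcases h c with ⟨g, i, h⟩ | ⟨z, hz, h⟩
  · exact Or.inl ⟨g, i, fun k => h k (hc' ▸ Subgroup.mem_top k)⟩
  · exact Or.inr ⟨z, hz ▸ hc', h⟩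

/-- The groups that occur as factors in a complete decomposition. -/
structure IsPrimeFactor (G : Type*) [Group G] : Prop where
  indecomposable : IsIndecomposable G
  fg : Group.FG G
  hasFGFixed : HasFGFixed G

theorem IsPrimeFactor.of_equiv {G H : Type*} [Group G] [Group H] (h : IsPrimeFactor G)
    (e : G ≃* H) : IsPrimeFactor H :=
  ⟨h.1.of_equiv e, have := h.2; Group.fg_of_surjective (f := e.toMonoidHom) e.surjective,
    h.3.of_equiv e⟩

/-- A free decomposition whose factors decompose further into indecomposable factors. -/
theorem IsFreeDecomposition.exists_prime_of_factors {G ι : Type} [Group G] [Finite ι]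
    {S : ι → Subgroup G} (hS : IsFreeDecomposition S)
    (h : ∀ i, ∃ (J : Type) (R : J → Subgroup (S i)), Finite J ∧ IsFreeDecomposition R ∧
      ∀ j, IsPrimeFactor (R j)) :
    ∃ (J : Type) (R : J → Subgroup G), Finite J ∧ IsFreeDecomposition R ∧
      ∀ j, IsPrimeFactor (R j) := by
  choose J R hJ hR hprime using h
  exact ⟨Σ i, J i, _, inferInstance, hS.sigma hR, fun p => (hprime p.1 p.2).of_equiv
    ((R p.1 p.2).equivMapOfInjective (S p.1).subtype (S p.1).subtype_injective)⟩

theorem HasFGFixed.exists_prime_of_card (n : ℕ) : ∀ (G : Type) [Group G], HasFGFixed G →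
    ∀ s : Finset G, Subgroup.closure (s : Set G) = ⊤ → s.card ≤ n →
    ∃ (J : Type) (R : J → Subgroup G), Finite J ∧ IsFreeDecomposition R ∧
      ∀ j, IsPrimeFactor (R j) := by
  classical
  induction n using Nat.strong_induction_on with
  | _ n ih =>
    intro G _ hG s hs hsn
    have hfg : Group.FG G := ⟨⟨s, hs⟩⟩
    rcases subsingleton_or_nontrivial G with hsub | hnt
    · exact ⟨Empty, isEmptyElim, inferInstance, .of_isEmpty, isEmptyElim⟩
    by_cases hind : IsIndecomposable G
    · exact ⟨Unit, fun _ => ⊤, inferInstance, .of_unique rfl, fun _ =>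
        IsPrimeFactor.of_equiv ⟨hind, hfg, hG⟩ Subgroup.topEquiv.symm⟩
    · simp only [IsIndecomposable, hnt, true_and, not_forall, not_or] at hind
      obtain ⟨T, hT, ht, hf⟩ := hind
      refine hT.exists_prime_of_factors ?_
      obtain ⟨e, -⟩ := hT.exists_mulEquiv
      obtain ⟨U, hU, hcard⟩ := CoprodI.exists_generators (s.image e) (by
        rw [Finset.coe_image]
        have := MonoidHom.map_closure e.toMonoidHom (s : Set G)
        rw [hs, ← MonoidHom.range_eq_map, MonoidHom.range_eq_top.2 e.surjective] at this
        exact this.symm)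
      have hpos (b : Bool) (hb : T b ≠ ⊥) : 0 < (U b).card := by
        rw [Finset.card_pos, Finset.nonempty_iff_ne_empty]
        intro h0
        have := hU b
        rw [h0, Finset.coe_empty, Subgroup.closure_empty] at this
        have h1 := (Subgroup.subsingleton_iff.1 (subsingleton_of_bot_eq_top this))
        exact hb ((Subgroup.eq_bot_iff_forall _).2 fun x hx =>
          congrArg Subtype.val (Subsingleton.elim (⟨x, hx⟩ : T b) 1))
      have h1 := hpos _ ht
      have h2 := hpos _ hf
      have h3 := hcard.trans (Finset.card_image_le.trans hsn)
      rw [Fintype.sum_bool] at h3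
      rintro (_ | _)
      · exact ih (U false).card (by omega) _ (hT.hasFGFixed_factor hG false) _ (hU false) le_rfl
      · exact ih (U true).card (by omega) _ (hT.hasFGFixed_factor hG true) _ (hU true) le_rfl

theorem HasFGFixed.exists_prime {G : Type} [Group G] [hfg : Group.FG G] (hG : HasFGFixed G) :
    ∃ (J : Type) (R : J → Subgroup G), Finite J ∧ IsFreeDecomposition R ∧
      ∀ j, IsPrimeFactor (R j) := by
  obtain ⟨s, hs⟩ := hfg.out
  exact HasFGFixed.exists_prime_of_card _ G hG s hs le_rfl

namespace GraphOfGroups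

variable {G V E : Type*} [Group G]

/-- The arcs of a graph with labelled edges and with vertex groups. -/
def arcs (src tgt : E → V) (lab : E → G) (P : V → Subgroup G) : Set (V × G × V) :=
  {q | (∃ e, q = (src e, lab e, tgt e)) ∨ (q.1 = q.2.2 ∧ q.2.1 ∈ P q.1)}

/-- Adjacency in a graph. -/
def Adj (src tgt : E → V) (u v : V) : Prop :=
  ∃ e, (src e = u ∧ tgt e = v) ∨ (src e = v ∧ tgt e = u)

/-- A maximal tree in the component of `v₀`. -/
structure SpanningTree (src tgt : E → V) (lab : E → G) (v₀ : V) where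
  /-- the vertices of the component -/
  reach : V → Prop
  /-- the label of the path in the tree from the root -/
  θ : V → G
  /-- the parent of a vertex -/
  par : V → V
  /-- the edge to the parent -/
  parEdge : V → E
  /-- the distance from the root -/
  depth : V → ℕ
  reach_root : reach v₀
  reach_iff : ∀ e, reach (src e) ↔ reach (tgt e)
  θ_root : θ v₀ = 1
  reach_par : ∀ v, reach v → v ≠ v₀ → reach (par v)
  depth_par : ∀ v, reach v → v ≠ v₀ → depth (par v) < depth v
  ends : ∀ v, reach v → v ≠ v₀ → (src (parEdge v) = par v ∧ tgt (parEdge v) = v) ∨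
    (src (parEdge v) = v ∧ tgt (parEdge v) = par v)
  θ_edge : ∀ v, reach v → v ≠ v₀ →
    θ (src (parEdge v)) * lab (parEdge v) * (θ (tgt (parEdge v)))⁻¹ = 1

theorem exists_spanningTree [Nonempty E] (src tgt : E → V) (lab : E → G) (v₀ : V) :
    Nonempty (SpanningTree src tgt lab v₀) := by
  classical
  obtain ⟨d, hd⟩ := exists_depth (Adj src tgt) v₀
  have : Nonempty V := ⟨v₀⟩
  choose! par hreach hadj hdepth using hd
  choose! pe hpe using hadj
  let θ : V → G := (measure d).wf.fix fun v rec =>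
    if h : d (par v) < d v ∧ v ≠ v₀ then
      if src (pe v) = par v ∧ tgt (pe v) = v then rec (par v) h.1 * lab (pe v)
      else rec (par v) h.1 * (lab (pe v))⁻¹
    else 1
  have hθ (v : V) : θ v = if h : d (par v) < d v ∧ v ≠ v₀ then
      if src (pe v) = par v ∧ tgt (pe v) = v then θ (par v) * lab (pe v)
      else θ (par v) * (lab (pe v))⁻¹ else 1 := WellFounded.fix_eq _ _ v
  refine ⟨⟨Relation.ReflTransGen (Adj src tgt) v₀, θ, par, pe, d, .refl, fun e =>
    ⟨fun h => h.tail ⟨e, Or.inl ⟨rfl, rfl⟩⟩, fun h => h.tail ⟨e, Or.inr ⟨rfl, rfl⟩⟩⟩, ?_, hreach,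
    hdepth, hpe, fun v hv hne => ?_⟩⟩
  · rw [hθ, dif_neg (by simp)]
  · have h1 := hθ v
    rw [dif_pos ⟨hdepth v hv hne, hne⟩] at h1
    split_ifs at h1 with h2
    · rw [h2.1, h2.2, h1]
      simp
    · obtain ⟨h3, h4⟩ := (hpe v hv hne).resolve_left h2
      rw [h3, h4, h1]
      simp

namespace SpanningTree

variable {src tgt : E → V} {lab : E → G} {v₀ : V} (T : SpanningTree src tgt lab v₀)

theorem parEdge_injective {v w : V} (hv : T.reach v) (hw : T.reach w) (hv0 : v ≠ v₀)
    (hw0 : w ≠ v₀) (h : T.parEdge v = T.parEdge w) : v = w := by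
  have hdv := T.depth_par v hv hv0
  have hdw := T.depth_par w hw hw0
  rcases T.ends v hv hv0 with ⟨h1, h2⟩ | ⟨h1, h2⟩ <;>
    rcases T.ends w hw hw0 with ⟨h3, h4⟩ | ⟨h3, h4⟩ <;> rw [h] at h1 h2
  · exact h2.symm.trans h4
  · rw [← h1, h3, ← h2, h4] at hdv
    omega
  · rw [← h2, h4, ← h1, h3] at hdv
    omega
  · exact h1.symm.trans h3

/-- A finite set of vertices lies in a finite subtree. -/
theorem exists_subtree (W : Finset V) (hW : ∀ v ∈ W, T.reach v) :
    ∃ U : Finset V, W ⊆ U ∧ v₀ ∈ U ∧ ∀ v ∈ U, T.reach v ∧ (v ≠ v₀ → T.par v ∈ U) := by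
  classical
  have h1 (v : V) (hv : T.reach v) :
      ∃ U : Finset V, v ∈ U ∧ ∀ v ∈ U, T.reach v ∧ (v ≠ v₀ → T.par v ∈ U) := by
    induction h : T.depth v using Nat.strong_induction_on generalizing v with
    | _ n ih =>
      by_cases hv0 : v = v₀
      · exact ⟨{v}, by simp, fun w hw => by simp_all⟩
      · obtain ⟨U, hU, hU'⟩ := ih _ (h ▸ T.depth_par v hv hv0) _ (T.reach_par v hv hv0) rfl
        refine ⟨insert v U, by simp, fun w hw => ?_⟩
        rcases Finset.mem_insert.1 hw with rfl | hw
        · exact ⟨hv, fun _ => Finset.mem_insert_of_mem hU⟩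
        · exact ⟨(hU' w hw).1, fun h => Finset.mem_insert_of_mem ((hU' w hw).2 h)⟩
  induction W using Finset.induction_on with
  | empty =>
    obtain ⟨U, hU, hU'⟩ := h1 v₀ T.reach_root
    exact ⟨U, by simp, hU, hU'⟩
  | insert w W _ ih =>
    obtain ⟨U, hU, hU'⟩ := h1 w (hW w (by simp))
    obtain ⟨U₁, hU₁, h0, hU₁'⟩ := ih fun v hv => hW v (by simp [hv])
    refine ⟨U ∪ U₁, ?_, by simp [h0], fun v hv => ?_⟩
    · exact Finset.insert_subset (by simp [hU]) (hU₁.trans Finset.subset_union_right)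
    · rcases Finset.mem_union.1 hv with hv | hv
      · exact ⟨(hU' v hv).1, fun h => Finset.mem_union_left _ ((hU' v hv).2 h)⟩
      · exact ⟨(hU₁' v hv).1, fun h => Finset.mem_union_right _ ((hU₁' v hv).2 h)⟩

/-- The edges of the component outside the tree. -/
def coTree : Set E :=
  {e | T.reach (src e) ∧ ∀ v, T.reach v → v ≠ v₀ → T.parEdge v ≠ e}

/-- If almost all edges can be assigned injectively to one of their end points, then a component
has few edges outside a maximal tree and few vertices that are not assigned. -/
theorem card_coTree_le {bad : Set E} (hbad : bad.Finite) {tail : E → V}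
    (htail : ∀ e ∉ bad, tail e = src e ∨ tail e = tgt e) (hinj : Set.InjOn tail badᶜ)
    {A : Finset E} (hA : ↑A ⊆ T.coTree) {B : Finset V} (hB : ∀ v ∈ B, T.reach v)
    (hBtail : ∀ e ∉ bad, tail e ∉ B) : A.card + B.card ≤ hbad.toFinset.card + 1 := by
  classical
  obtain ⟨U, hWU, h0, hU⟩ := T.exists_subtree (A.image src ∪ A.image tgt ∪ B) (by
    intro v hv
    simp only [Finset.mem_union, Finset.mem_image] at hv
    rcases hv with (⟨e, he, rfl⟩ | ⟨e, he, rfl⟩) | hv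
    · exact (hA he).1
    · exact (T.reach_iff e).1 (hA he).1
    · exact hB v hv)
  have hBU : B ⊆ U := Finset.subset_union_right.trans hWU
  have hcardT : ((U.erase v₀).image T.parEdge).card = U.card - 1 := by
    rw [Finset.card_image_of_injOn, Finset.card_erase_of_mem h0]
    intro v hv w hw h
    obtain ⟨hv0, hv⟩ := Finset.mem_erase.1 hv
    obtain ⟨hw0, hw⟩ := Finset.mem_erase.1 hw
    exact T.parEdge_injective (hU v hv).1 (hU w hw).1 hv0 hw0 h
  have hdisj : Disjoint A ((U.erase v₀).image T.parEdge) := by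
    rw [Finset.disjoint_left]
    intro e he he'
    obtain ⟨v, hv, rfl⟩ := Finset.mem_image.1 he'
    obtain ⟨hv0, hv⟩ := Finset.mem_erase.1 hv
    exact (hA he).2 v (hU v hv).1 hv0 rfl
  have hends (e : E) (he : e ∈ A ∪ (U.erase v₀).image T.parEdge) : src e ∈ U ∧ tgt e ∈ U := by
    rcases Finset.mem_union.1 he with he | he
    · exact ⟨hWU (Finset.mem_union_left _ (Finset.mem_union_left _ (Finset.mem_image_of_mem _ he))),
        hWU (Finset.mem_union_left _ (Finset.mem_union_right _ (Finset.mem_image_of_mem _ he)))⟩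
    · obtain ⟨v, hv, rfl⟩ := Finset.mem_image.1 he
      obtain ⟨hv0, hv⟩ := Finset.mem_erase.1 hv
      have hp := (hU v hv).2 hv0
      rcases T.ends v (hU v hv).1 hv0 with ⟨h1, h2⟩ | ⟨h1, h2⟩ <;> rw [h1, h2]
      · exact ⟨hp, hv⟩
      · exact ⟨hv, hp⟩
  have hle : ((A ∪ (U.erase v₀).image T.parEdge) \ hbad.toFinset).card ≤ (U \ B).card := by
    refine Finset.card_le_card_of_injOn tail (fun e he => ?_) fun e he e' he' h => ?_
    · simp only [Finset.coe_sdiff, Set.mem_sdiff, Finset.mem_coe, Set.Finite.mem_toFinset] at he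
      refine Finset.mem_sdiff.2 ⟨?_, hBtail e he.2⟩
      rcases htail e he.2 with h | h <;> rw [h]
      · exact (hends e he.1).1
      · exact (hends e he.1).2
    · simp only [Finset.coe_sdiff, Set.mem_sdiff, Finset.mem_coe, Set.Finite.mem_toFinset] at he he'
      exact hinj he.2 he'.2 h
  have h1 := Finset.le_card_sdiff hbad.toFinset (A ∪ (U.erase v₀).image T.parEdge)
  rw [Finset.card_union_of_disjoint hdisj, hcardT] at h1
  rw [Finset.card_sdiff_of_subset hBU] at hle
  have h2 := Finset.card_le_card hBU
  have h3 : 0 < U.card := Finset.card_pos.2 ⟨v₀, h0⟩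
  omega

end SpanningTree

theorem finite_of_finset_card_le {α : Type*} {s : Set α} {n : ℕ}
    (h : ∀ A : Finset α, ↑A ⊆ s → A.card ≤ n) : s.Finite := by
  by_contra hs
  obtain ⟨A, hA, hcard⟩ := Set.Infinite.exists_subset_card_eq hs (n + 1)
  have := h A hA
  omega

/-- A graph of groups in which almost all edges can be assigned injectively to end points with
trivial vertex group has a finitely generated fundamental group. -/
theorem fg_of_flow [Nonempty E] (src tgt : E → V) (lab : E → G) (P : V → Subgroup G)
    (hP : ∀ v, (P v).FG) (v₀ : V) (H : Subgroup G)
    (hH : ∀ g, g ∈ H ↔ Conn (arcs src tgt lab P) v₀ g v₀) {bad : Set E} (hbad : bad.Finite)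
    (tail : E → V) (htail : ∀ e ∉ bad, tail e = src e ∨ tail e = tgt e)
    (hinj : Set.InjOn tail badᶜ) (hPtail : ∀ e ∉ bad, P (tail e) = ⊥) : H.FG := by
  classical
  obtain ⟨T⟩ := exists_spanningTree src tgt lab v₀
  have hN : T.coTree.Finite := finite_of_finset_card_le fun A hA =>
    (Nat.le_add_right _ _).trans
      (T.card_coTree_le hbad htail hinj hA (B := ∅) (by simp) (by simp))
  have hverts : {v | T.reach v ∧ P v ≠ ⊥}.Finite := finite_of_finset_card_le fun B hB =>
    (Nat.le_add_left _ _).trans (T.card_coTree_le hbad htail hinj (A := ∅) (by simp) (B := B)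
      (fun v hv => (hB hv).1) fun e he h => (hB h).2 (hPtail e he))
  choose gen hgen using hP
  let n (e : E) : G := T.θ (src e) * lab e * (T.θ (tgt e))⁻¹
  let Γ : Set G := n '' T.coTree ∪ ⋃ v ∈ {v | T.reach v ∧ P v ≠ ⊥},
    (fun p => T.θ v * p * (T.θ v)⁻¹) '' (gen v : Set G)
  have hΓ : Γ.Finite := (hN.image n).union
    (hverts.biUnion fun v _ => (gen v).finite_toSet.image _)
  have hθ (v : V) (hv : T.reach v) : Conn (arcs src tgt lab P) v₀ (T.θ v) v := by
    induction h : T.depth v using Nat.strong_induction_on generalizing v with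
    | _ k ih =>
      by_cases hv0 : v = v₀
      · rw [hv0, T.θ_root]
        exact .refl v₀
      · have h1 := ih _ (h ▸ T.depth_par v hv hv0) _ (T.reach_par v hv hv0) rfl
        have h2 := T.θ_edge v hv hv0
        have h3 : Conn (arcs src tgt lab P) _ _ _ := .of (Or.inl ⟨T.parEdge v, rfl⟩)
        rcases T.ends v hv hv0 with ⟨h4, h5⟩ | ⟨h4, h5⟩ <;> rw [h4, h5] at h2 h3
        · exact (h1.trans h3).of_eq (mul_inv_eq_one.1 h2)
        · exact (h1.trans h3.symm).of_eq (mul_inv_eq_of_eq_mul (mul_inv_eq_one.1 h2).symm)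
  have hnH (e : E) (he : T.reach (src e)) : n e ∈ H := by
    rw [hH]
    exact ((hθ _ he).trans (.of (Or.inl ⟨e, rfl⟩))).trans (hθ _ ((T.reach_iff e).1 he)).symm
  have hPH (v : V) (hv : T.reach v) (p : G) (hp : p ∈ P v) :
      T.θ v * p * (T.θ v)⁻¹ ∈ H := by
    rw [hH]
    exact ((hθ v hv).trans (.of (Or.inr ⟨rfl, hp⟩))).trans (hθ v hv).symm
  have hreach {x y : V} {g : G} (h : Conn (arcs src tgt lab P) x g y) : T.reach x ↔ T.reach y := by
    refine h.iff_of_arcs ?_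
    rintro x g y (⟨e, he⟩ | ⟨hxy, -⟩)
    · obtain ⟨rfl, rfl, rfl⟩ : _ ∧ _ ∧ _ := by simpa using he
      exact T.reach_iff e
    · dsimp only at hxy
      rw [hxy]
  have hclosure {x y : V} {g : G} (h : Conn (arcs src tgt lab P) x g y) :
      T.reach x → T.θ x * g * (T.θ y)⁻¹ ∈ Subgroup.closure Γ := by
    induction h with
    | refl x => simp [one_mem]
    | @of x g y hs =>
      intro hx
      rcases hs with ⟨e, he⟩ | ⟨hxy, hg⟩
      · obtain ⟨rfl, rfl, rfl⟩ : _ ∧ _ ∧ _ := by simpa using he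
        by_cases hN : e ∈ T.coTree
        · exact Subgroup.subset_closure (Or.inl ⟨e, hN, rfl⟩)
        · simp only [SpanningTree.coTree, Set.mem_ofPred_eq, hx, true_and, not_forall,
            not_not] at hN
          obtain ⟨v, hv, hv0, rfl⟩ := hN
          rw [T.θ_edge v hv hv0]
          exact one_mem _
      · dsimp only at hxy hg
        subst hxy
        have hle : P x ≤ (Subgroup.closure Γ).comap (MulAut.conj (T.θ x)).toMonoidHom := by
          by_cases hbot : P x = ⊥
          · rw [hbot]
            exact bot_le
          · rw [← hgen x, Subgroup.closure_le]
            intro p hp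
            exact Subgroup.subset_closure (Or.inr
              (Set.mem_biUnion (show x ∈ {v | _} from ⟨hx, hbot⟩) ⟨p, hp, rfl⟩))
        exact hle hg
    | @symm x g y h ih =>
      intro hy
      have := inv_mem (ih ((hreach h).2 hy))
      simpa [mul_assoc] using this
    | @trans x g y g' z h h' ih ih' =>
      intro hx
      have := mul_mem (ih hx) (ih' ((hreach h).1 hx))
      simpa [mul_assoc] using this
  refine (Subgroup.fg_iff H).2 ⟨Γ, le_antisymm ?_ fun g hg => ?_, hΓ⟩
  · rw [Subgroup.closure_le]
    rintro g (⟨e, he, rfl⟩ | hg)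
    · exact hnH e he.1
    · simp only [Set.mem_iUnion] at hg
      obtain ⟨v, hv, p, hp, rfl⟩ := hg
      exact hPH v hv.1 p (hgen v ▸ Subgroup.subset_closure hp)
  · have := hclosure ((hH g).1 hg) T.reach_root
    simpa [T.θ_root] using this

end GraphOfGroups

section

section Twist

variable {G : Type*} [Group G]

/-- The action of a group on itself by twisted conjugation. -/
def twist (φ : G ≃* G) (h x : G) : G :=
  h * x * (φ h)⁻¹

variable {φ : G ≃* G}

@[simp]
theorem twist_one (x : G) : twist φ 1 x = x := by simp [twist]

theorem twist_mul (h k x : G) : twist φ (h * k) x = twist φ h (twist φ k x) := by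
  simp [twist, mul_assoc]

@[simp]
theorem twist_inv_twist (h x : G) : twist φ h⁻¹ (twist φ h x) = x := by
  rw [← twist_mul, inv_mul_cancel, twist_one]

@[simp]
theorem twist_twist_inv (h x : G) : twist φ h (twist φ h⁻¹ x) = x := by
  rw [← twist_mul, mul_inv_cancel, twist_one]

theorem twist_injective (h : G) : Function.Injective (twist φ h) :=
  Function.LeftInverse.injective (twist_inv_twist h)

theorem mem_fixedSubgroup_iff_twist {g : G} :
    g ∈ fixedSubgroup (φ : G →* G) ↔ twist φ g 1 = 1 := by
  rw [mem_fixedSubgroup, twist, mul_one, mul_inv_eq_one]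
  exact eq_comm

/-- The elements whose action is realized by paths in a graph. -/
def pathSubgroup (φ : G ≃* G) {V : Type*} (A : Set (V × G × V)) (f : G → V) : Subgroup G where
  carrier := {h | ∀ x, Conn A (f (twist φ h x)) h (f x)}
  one_mem' x := by
    rw [twist_one]
    exact .refl _
  mul_mem' {h k} hh hk x := by
    rw [twist_mul]
    exact (hh _).trans (hk x)
  inv_mem' {h} hh x := by
    have := (hh (twist φ h⁻¹ x)).symm
    rwa [twist_twist_inv] at this

end Twist

open GraphOfGroups

variable {G ι : Type*} [Group G] {S : ι → Subgroup G}

/-- The part of a graph of groups for the stabilizers of twisted conjugation that realizes the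
action of one factor. -/
structure TwistPiece (φ : G ≃* G) (L : LeadingLetters S) (j : ι) where
  /-- the end points of the edges: points of the group or orbits of the factor -/
  tgt : G → G ⊕ G
  /-- the labels of the edges -/
  lab : G → G
  /-- the stabilizers of the base points of the orbits -/
  grp : G → Subgroup G
  /-- the edges that are not assigned to an end point -/
  bad : Set G
  /-- the end points that the other edges are assigned to -/
  tail : G → G ⊕ G
  grp_fg : ∀ b, (grp b).FG
  bad_finite : bad.Finite
  tail_eq : ∀ x ∉ bad, tail x = Sum.inl x ∨ tail x = tgt x
  tail_injOn : Set.InjOn tail badᶜ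
  leading_ne_one : ∀ x ∉ bad, ∀ p, tail x = Sum.inl p → L.toFun j p ≠ 1
  grp_tail : ∀ x ∉ bad, ∀ b, tail x = Sum.inr b → grp b = ⊥
  twist_lab : ∀ x, twist φ (lab x) ((tgt x).elim id id) = x
  twist_grp : ∀ b, ∀ h ∈ grp b, twist φ h b = b
  le_pathSubgroup :
    S j ≤ pathSubgroup φ (arcs Sum.inl tgt lab (Sum.elim (fun _ => ⊥) grp)) Sum.inl

/-- The pieces of all factors assemble to a graph of groups that computes the fixed subgroup. -/
theorem fg_fixedSubgroup_of_twistPiece [Finite ι] [Nonempty ι] (htop : ⨆ i, S i = ⊤)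
    {φ : G ≃* G} {L : LeadingLetters S} (Q : ∀ j, TwistPiece φ L j) :
    (fixedSubgroup (φ : G →* G)).FG := by
  let emb (j : ι) : G ⊕ G → G ⊕ ι × G := Sum.map id (Prod.mk j)
  have hemb (j : ι) : Function.Injective (emb j) :=
    Sum.map_injective.2 ⟨Function.injective_id, Prod.mk_right_injective j⟩
  let src (e : G × ι) : G ⊕ ι × G := Sum.inl e.1
  let tgt (e : G × ι) : G ⊕ ι × G := emb e.2 ((Q e.2).tgt e.1)
  let lab (e : G × ι) : G := (Q e.2).lab e.1
  let P : G ⊕ ι × G → Subgroup G := Sum.elim (fun _ => ⊥) fun p => (Q p.1).grp p.2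
  let pos : G ⊕ ι × G → G := Sum.elim id Prod.snd
  have hpos (j : ι) (v : G ⊕ G) : pos (emb j v) = v.elim id id := by cases v <;> rfl
  have hsound {x y : G ⊕ ι × G} {g : G} (h : Conn (arcs src tgt lab P) x g y) :
      twist φ g (pos y) = pos x := by
    induction h with
    | refl x => simp
    | @of x g y hs =>
      rcases hs with ⟨e, he⟩ | ⟨hxy, hg⟩
      · obtain ⟨rfl, rfl, rfl⟩ : _ ∧ _ ∧ _ := by simpa using he
        exact (congrArg _ (hpos _ _)).trans ((Q e.2).twist_lab e.1)
      · dsimp only at hxy hg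
        subst hxy
        rcases x with x | ⟨j, b⟩
        · obtain rfl : g = 1 := hg
          simp
        · exact (Q j).twist_grp b g hg
    | symm _ ih => rw [← ih, twist_inv_twist]
    | trans _ _ ih ih' => rw [twist_mul, ih', ih]
  have hpath : pathSubgroup φ (arcs src tgt lab P) Sum.inl = ⊤ := by
    rw [eq_top_iff, ← htop]
    refine iSup_le fun j h hh x => ?_
    refine ((Q j).le_pathSubgroup hh x).map_hom (emb j) (MonoidHom.id G) ?_
    rintro x g y (⟨e, he⟩ | ⟨hxy, hg⟩)
    · obtain ⟨rfl, rfl, rfl⟩ : _ ∧ _ ∧ _ := by simpa using he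
      exact .of (Or.inl ⟨(e, j), rfl⟩)
    · dsimp only at hxy hg
      subst hxy
      refine .of (Or.inr ⟨rfl, ?_⟩)
      rcases x with x | b <;> exact hg
  refine fg_of_flow src tgt lab P ?_ (Sum.inl 1) _ (fun g => ?_)
    (bad := ⋃ j, (fun x => (x, j)) '' (Q j).bad)
    (Set.finite_iUnion fun j => (Q j).bad_finite.image _) (fun e => emb e.2 ((Q e.2).tail e.1))
    ?_ ?_ ?_
  · rintro (x | ⟨j, b⟩)
    · exact Subgroup.FG.bot
    · exact (Q j).grp_fg b
  · rw [mem_fixedSubgroup_iff_twist]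
    refine ⟨fun hg => ?_, fun hg => hsound hg⟩
    have := (hpath ▸ Subgroup.mem_top g : g ∈ pathSubgroup φ (arcs src tgt lab P) Sum.inl) 1
    rwa [hg] at this
  all_goals have hbad {e : G × ι} (he : e ∉ ⋃ j, (fun x => (x, j)) '' (Q j).bad) :
      e.1 ∉ (Q e.2).bad := fun h => he (Set.mem_iUnion.2 ⟨e.2, e.1, h, rfl⟩)
  · intro e he
    rcases (Q e.2).tail_eq _ (hbad he) with h | h <;> rw [h]
    · exact Or.inl rfl
    · exact Or.inr rfl
  · rintro ⟨x, j⟩ hx ⟨y, i⟩ hy h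
    have hx := hbad hx
    have hy := hbad hy
    dsimp only at h hx hy
    obtain rfl : j = i := by
      rcases hp : (Q j).tail x with p | b <;> rcases hq : (Q i).tail y with q | c <;>
        rw [hp, hq] at h
      · obtain rfl : p = q := Sum.inl_injective h
        exact L.index_eq ((Q j).leading_ne_one x hx p hp) ((Q i).leading_ne_one y hy p hq)
      · cases h
      · cases h
      · exact congrArg Prod.fst (Sum.inr_injective h)
    rw [(Q j).tail_injOn hx hy (hemb j h)]
  · intro e he
    rcases hp : (Q e.2).tail e.1 with p | b
    · rfl
    · exact (Q e.2).grp_tail _ (hbad he) b hp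

theorem LeadingLetters.coe_toFun_mul {L : LeadingLetters S} {j : ι} {h : G} (hh : h ∈ S j) (x : G) :
    (L.toFun j (h * x) : G) = h * L.toFun j x :=
  congrArg Subtype.val (L.map_mul j ⟨h, hh⟩ x)

/-- The piece of an infinite cyclic factor. -/
theorem exists_twistPiece_of_cyclic (htop : ⨆ i, S i = ⊤) (φ : G ≃* G) (L : LeadingLetters S)
    {j : ι} {t : G} (ht : Subgroup.zpowers t = S j) (ht' : ∀ n : ℤ, t ^ n = 1 → n = 0) :
    Nonempty (TwistPiece φ L j) := by
  have htS : t ∈ S j := ht ▸ Subgroup.mem_zpowers t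
  have hinj {m n : ℤ} (h : t ^ m = t ^ n) : m = n := by
    have := ht' (m - n) (by rw [zpow_sub, h, mul_inv_cancel])
    omega
  have hex (x : G) : ∃ n : ℤ, t ^ n = L.toFun j x :=
    Subgroup.mem_zpowers_iff.1 (ht.symm ▸ (L.toFun j x).2 : _ ∈ Subgroup.zpowers t)
  choose n hn using hex
  have hn_mul (m : ℤ) (x : G) : n (t ^ m * x) = m + n x := by
    apply hinj
    rw [hn, zpow_add, hn, L.coe_toFun_mul (zpow_mem htS m)]
  have hn_twist (x : G) : n (twist φ t x) = 1 + n (x * (φ t)⁻¹) := by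
    rw [← hn_mul, zpow_one, twist, mul_assoc]
  have hn1 {x : G} (h : n x ≠ 0) : L.toFun j x ≠ 1 := by
    intro h1
    have := hn x
    rw [h1] at this
    exact h (ht' _ this)
  obtain ⟨Z, hZ, hfin⟩ := L.finite_mul_right htop j (φ t)⁻¹
  refine ⟨⟨fun x => Sum.inl (twist φ t x), fun _ => t⁻¹, fun _ => ⊥,
    {x | 0 ≤ n x ∧ n (twist φ t x) ≤ 0},
    fun x => if n x < 0 then Sum.inl x else Sum.inl (twist φ t x), fun _ => Subgroup.FG.bot,
    ?_, fun x _ => ?_, ?_, fun x hx p h => ?_, fun _ _ _ _ => rfl, fun x => by simp,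
    fun b h hh => ?_, ?_⟩⟩
  · refine (hZ.biUnion fun z _ => (Set.finite_Icc (-n z) (-1 - n (z * (φ t)⁻¹))).image
      fun m => t ^ m * z).subset ?_
    rintro x ⟨h1, h2⟩
    rw [hn_twist] at h2
    obtain ⟨⟨h, hh⟩, z, hz, rfl⟩ := hfin x fun heq => by
      have h3 := hn (x * (φ t)⁻¹)
      rw [heq, ← hn] at h3
      have := hinj h3
      omega
    obtain ⟨m, rfl⟩ := Subgroup.mem_zpowers_iff.1 (ht ▸ hh)
    dsimp only at h1 h2
    rw [hn_mul] at h1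
    rw [mul_assoc, hn_mul] at h2
    exact Set.mem_biUnion hz ⟨m, ⟨by omega, by omega⟩, rfl⟩
  · split_ifs
    · exact Or.inl rfl
    · exact Or.inr rfl
  · intro x hx y hy h
    simp only [Set.mem_compl_iff, Set.mem_ofPred_eq, not_and, not_le] at hx hy
    dsimp only at h
    split_ifs at h with h1 h2 h2 <;> have h := Sum.inl_injective h
    · exact h
    · have := hy (by omega)
      rw [← h] at this
      omega
    · have := hx (by omega)
      rw [h] at this
      omega
    · exact twist_injective t h
  · simp only [Set.mem_ofPred_eq, not_and, not_le] at hx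
    split_ifs at h with h1 <;> have h := Sum.inl_injective h <;> subst h
    · exact hn1 h1.ne
    · exact hn1 (hx (by omega)).ne'
  · obtain rfl : h = 1 := hh
    simp
  · rw [← ht, Subgroup.zpowers_le]
    intro x
    exact (Conn.symm (.of (Or.inl ⟨x, rfl⟩))).of_eq (inv_inv t)

/-- The stabilizer of a point in a factor, under twisted conjugation. -/
def twistStabilizer (φ : G ≃* G) (K : Subgroup G) (b : G) : Subgroup G where
  carrier := {h | h ∈ K ∧ twist φ h b = b}
  one_mem' := ⟨one_mem K, twist_one b⟩
  mul_mem' {h k} hh hk := ⟨mul_mem hh.1 hk.1, by rw [twist_mul, hk.2, hh.2]⟩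
  inv_mem' {h} hh := ⟨inv_mem hh.1, by rw [← hh.2, twist_inv_twist, hh.2]⟩

theorem fg_twistStabilizer {φ : G ≃* G} (L : LeadingLetters S) {j σ τ : ι}
    (hfix : HasFGFixed (S j)) {u v : G} (hu : ∀ k ∈ S j, u⁻¹ * φ k * u ∈ S σ)
    (hv : ∀ k ∈ S j, v⁻¹ * φ.symm k * v ∈ S τ) (b : G) : (twistStabilizer φ (S j) b).FG := by
  by_cases hbot : twistStabilizer φ (S j) b = ⊥
  · rw [hbot]
    exact Subgroup.FG.bot
  obtain ⟨⟨h₀, h₀S, h₀b⟩, hne⟩ := Subgroup.ne_bot_iff_exists_ne_one.1 hbot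
  have h₀1 : h₀ ≠ 1 := fun h1 => hne (Subtype.ext h1)
  have hfixed {h : G} : twist φ h b = b ↔ b * φ h * b⁻¹ = h := by
    rw [twist, mul_inv_eq_iff_eq_mul, mul_inv_eq_iff_eq_mul, eq_comm]
  obtain ⟨rfl, hbu⟩ : σ = j ∧ b * u ∈ S j := by
    refine L.malnormal h₀S h₀1 (hu h₀ h₀S) ?_
    nth_rewrite 1 [← hfixed.1 h₀b]
    group
  have hmaps (h : G) (hh : h ∈ S σ) : b * φ h * b⁻¹ ∈ S σ := by
    have := mul_mem (mul_mem hbu (hu h hh)) (inv_mem hbu)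
    convert this using 1
    group
  obtain ⟨rfl, hbv⟩ : τ = σ ∧ φ.symm b⁻¹ * v ∈ S σ := by
    refine L.malnormal h₀S h₀1 (hv h₀ h₀S) ?_
    nth_rewrite 2 [← hfixed.1 h₀b]
    simp only [map_mul, map_inv, MulEquiv.symm_apply_apply]
    group
  have hmaps' (s : G) (hs : s ∈ S τ) : φ.symm (b⁻¹ * s * b) ∈ S τ := by
    have := mul_mem (mul_mem hbv (hv s hs)) (inv_mem hbv)
    convert this using 1
    simp only [map_mul, map_inv]
    group
  let ψ : S τ ≃* S τ :=
    { toFun := fun h => ⟨b * φ h * b⁻¹, hmaps h h.2⟩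
      invFun := fun s => ⟨φ.symm (b⁻¹ * s * b), hmaps' s s.2⟩
      left_inv := fun h => Subtype.ext (by simp [mul_assoc])
      right_inv := fun h => Subtype.ext (by simp [mul_assoc])
      map_mul' := fun h k => Subtype.ext (by simp [mul_assoc]) }
  have heq : twistStabilizer φ (S τ) b = (fixedSubgroup (ψ : S τ →* S τ)).map (S τ).subtype := by
    ext h
    rw [Subgroup.mem_map]
    constructor
    · rintro ⟨hh, hb⟩
      exact ⟨⟨h, hh⟩, Subtype.ext (hfixed.1 hb), rfl⟩
    · rintro ⟨h, hh, rfl⟩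
      exact ⟨h.2, hfixed.2 (congrArg Subtype.val hh)⟩
  rw [heq, Subgroup.fg_iff_submonoid_fg]
  exact ((Subgroup.fg_iff_submonoid_fg _).1 ((Group.fg_iff_subgroup_fg _).1 (hfix ψ))).map _

/-- The piece of a factor with a conjugate of a factor as its image. -/
theorem exists_twistPiece_of_conj (htop : ⨆ i, S i = ⊤) (φ : G ≃* G) (L : LeadingLetters S)
    {j σ τ : ι} (hfix : HasFGFixed (S j)) {u v : G} (hu : ∀ k ∈ S j, u⁻¹ * φ k * u ∈ S σ)
    (hv : ∀ k ∈ S j, v⁻¹ * φ.symm k * v ∈ S τ) : Nonempty (TwistPiece φ L j) := by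
  classical
  let r (x : G) : G := Classical.epsilon fun y => ∃ h ∈ S j, twist φ h x = y
  have hr (x : G) : ∃ h ∈ S j, twist φ h x = r x :=
    Classical.epsilon_spec (p := fun y => ∃ h ∈ S j, twist φ h x = y) ⟨_, 1, one_mem _, rfl⟩
  have hr_twist (h : G) (hh : h ∈ S j) (x : G) : r (twist φ h x) = r x := by
    refine congrArg Classical.epsilon (funext fun y => propext ⟨?_, ?_⟩)
    · rintro ⟨k, hk, rfl⟩
      exact ⟨k * h, mul_mem hk hh, twist_mul k h x⟩
    · rintro ⟨k, hk, rfl⟩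
      exact ⟨k * h⁻¹, mul_mem hk (inv_mem hh), by rw [twist_mul, twist_inv_twist]⟩
  choose c hc hcr using hr
  let bad : Set G := {x | L.toFun j x = 1 ∧ ∃ h ∈ S j, h ≠ 1 ∧ L.toFun j (twist φ h x) = 1}
  refine ⟨⟨fun x => Sum.inr (r x), fun x => (c x)⁻¹, twistStabilizer φ (S j), bad,
    fun x => if L.toFun j x = 1 then Sum.inr (r x) else Sum.inl x,
    fg_twistStabilizer L hfix hu hv, ?_, fun x _ => ?_, ?_, fun x _ p h => ?_,
    fun x hx b h => ?_, fun x => ?_, fun b h hh => hh.2, fun h hh x => ?_⟩⟩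
  · have h1 := L.finite_leading_eq_one htop j u
    have h2 := L.finite_leading_eq_one htop j u⁻¹
    refine ((h1.union (Set.finite_singleton u⁻¹)).union
      (h2.image fun y => y * u⁻¹ * φ (L.toFun j (y * u⁻¹) : G)⁻¹)).subset ?_
    rintro x ⟨hx, h, hh, hne, hhx⟩
    by_cases hxu : L.toFun j (x * u) = 1
    swap
    · exact Or.inl (Or.inl ⟨hx, hxu⟩)
    have hk := hu h hh
    by_cases hy : σ = j ∧ x * u ∈ S j
    · left
      right
      have := L.coe_toFun_mul hy.2 1
      rw [mul_one, hxu, L.map_one] at this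
      exact eq_inv_of_mul_eq_one_left (by simpa using this.symm)
    right
    have hlet := L.mul_right ⟨_, inv_mem hk⟩ (x * u) j fun h1 h2 => hy ⟨h1, h2⟩
    rw [hxu] at hlet
    have hxh : x * u * (u⁻¹ * φ h * u)⁻¹ * u⁻¹ = x * (φ h)⁻¹ := by group
    have hval : (L.toFun j (x * (φ h)⁻¹) : G) = h⁻¹ := by
      have := L.coe_toFun_mul hh (x * (φ h)⁻¹)
      rw [← mul_assoc] at this
      change (L.toFun j (twist φ h x) : G) = _ at this
      rw [hhx] at this
      exact (inv_eq_of_mul_eq_one_right this.symm).symm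
    refine ⟨x * u * (u⁻¹ * φ h * u)⁻¹, ⟨hlet, fun h1 => ?_⟩, ?_⟩
    · rw [hxh] at h1
      rw [h1] at hval
      exact hne (inv_eq_one.1 hval.symm)
    · dsimp only
      rw [hxh, hval]
      simp
  · split_ifs
    · exact Or.inr rfl
    · exact Or.inl rfl
  · intro x hx y hy h
    dsimp only at h
    split_ifs at h with h1 h2 h2
    · have h : r x = r y := Sum.inr_injective h
      have hxy : twist φ ((c y)⁻¹ * c x) x = y := by
        rw [twist_mul, hcr, h, ← hcr, twist_inv_twist]
      by_contra hne
      refine hx ⟨h1, _, mul_mem (inv_mem (hc y)) (hc x), fun h3 => hne ?_, by rwa [hxy]⟩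
      rw [← hxy, h3, twist_one]
    · exact Sum.inl_injective h
  · split_ifs at h with h1
    rwa [← Sum.inl_injective h]
  · split_ifs at h with h1
    obtain rfl := Sum.inr_injective h
    by_contra hne
    obtain ⟨⟨k, hk, hkr⟩, hk1⟩ := Subgroup.ne_bot_iff_exists_ne_one.1 hne
    refine hx ⟨h1, (c x)⁻¹ * k * c x, mul_mem (mul_mem (inv_mem (hc x)) hk) (hc x),
      fun h2 => hk1 (Subtype.ext ?_), ?_⟩
    · simpa [mul_assoc, inv_mul_eq_one] using h2
    · rwa [twist_mul, hcr, twist_mul, hkr, ← hcr, twist_inv_twist]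
  · change twist φ (c x)⁻¹ (r x) = x
    rw [← hcr, twist_inv_twist]
  · let A := arcs Sum.inl (fun x => Sum.inr (r x)) (fun x => (c x)⁻¹)
      (Sum.elim (fun _ : G => ⊥) (twistStabilizer φ (S j)))
    have harc (x : G) : Conn A (Sum.inl x) (c x)⁻¹ (Sum.inr (r x)) := .of (Or.inl ⟨x, rfl⟩)
    have h1 := harc (twist φ h x)
    rw [hr_twist h hh] at h1
    have h2 : Conn A (Sum.inr (r x)) (c (twist φ h x) * h * (c x)⁻¹) (Sum.inr (r x)) := by
      refine .of (Or.inr ⟨rfl, mul_mem (mul_mem (hc _) hh) (inv_mem (hc x)), ?_⟩)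
      rw [twist_mul, ← hcr x, twist_inv_twist, twist_mul, hcr, hr_twist h hh, hcr]
    exact ((h1.trans h2).trans (harc x).symm).of_eq (by group)

/-- A free product of prime factors has finitely generated fixed subgroups of automorphisms. -/
theorem IsFreeDecomposition.hasFGFixed_of_prime {G ι : Type} [Group G] [Finite ι]
    {S : ι → Subgroup G} (hS : IsFreeDecomposition S) (hprime : ∀ i, IsPrimeFactor (S i)) :
    HasFGFixed G := by
  intro φ
  obtain ⟨L⟩ := hS.nonempty_leadingLetters
  have htop := hS.iSup_eq_top
  rw [Group.fg_iff_subgroup_fg]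
  rcases isEmpty_or_nonempty ι with hι | hι
  · rw [iSup_of_empty] at htop
    have := subsingleton_of_bot_eq_top htop
    rw [Subsingleton.elim (fixedSubgroup _) ⊥]
    exact Subgroup.FG.bot
  · refine fg_fixedSubgroup_of_twistPiece htop (φ := φ) (L := L) fun j => Nonempty.some ?_
    have hcyc : (∃ z : S j, Subgroup.zpowers z = ⊤ ∧ ∀ n : ℤ, z ^ n = 1 → n = 0) →
        Nonempty (TwistPiece φ L j) := by
      rintro ⟨z, hz, hz'⟩
      refine exists_twistPiece_of_cyclic htop φ L (t := z) ?_ fun n hn =>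
        hz' n (Subtype.ext (by simpa using hn))
      have := congrArg (Subgroup.map (S j).subtype) hz
      rwa [MonoidHom.map_zpowers, ← MonoidHom.range_eq_map, Subgroup.range_subtype] at this
    rcases (hprime j).indecomposable.conj_or_cyclic hS (φ.toMonoidHom.comp (S j).subtype)
      (φ.injective.comp Subtype.val_injective) with ⟨u, σ, hu⟩ | h
    swap
    · exact hcyc h
    rcases (hprime j).indecomposable.conj_or_cyclic hS (φ.symm.toMonoidHom.comp (S j).subtype)
      (φ.symm.injective.comp Subtype.val_injective) with ⟨v, τ, hv⟩ | h
    swap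
    · exact hcyc h
    exact exists_twistPiece_of_conj htop φ L (hprime j).hasFGFixed (u := u⁻¹) (v := v⁻¹)
      (fun k hk => by simpa using hu ⟨k, hk⟩) fun k hk => by simpa using hv ⟨k, hk⟩

end

/-- A free product `G₁ ∗ ⋯ ∗ G_n` has the finitely generated fixed subgroup property for
automorphisms (`FGFP_a`) if and only if every factor `Gᵢ` does. -/
theorem freeProduct_fgfp_automorphism_iff (n : ℕ)
    (G : Fin n → Type) [∀ i, Group (G i)] [∀ i, Group.FG (G i)] :
    (∀ φ : Monoid.CoprodI G ≃* Monoid.CoprodI G,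
        Group.FG ↥(fixedSubgroup (φ : Monoid.CoprodI G →* Monoid.CoprodI G))) ↔
      (∀ (i : Fin n) (f : G i ≃* G i),
        Group.FG ↥(fixedSubgroup (f : G i →* G i))) := by
  have e (i : Fin n) : G i ≃* (CoprodI.of : G i →* CoprodI G).range :=
    MonoidHom.ofInjective (CoprodI.of_injective i)
  have hS := IsFreeDecomposition.range_of (M := G)
  refine ⟨fun h i => (hS.hasFGFixed_factor h i).of_equiv (e i).symm, fun h => ?_⟩
  obtain ⟨J, R, hJ, hR, hprime⟩ := hS.exists_prime_of_factors fun i =>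
    have : Group.FG (CoprodI.of : G i →* CoprodI G).range :=
      Group.fg_of_surjective (f := (e i).toMonoidHom) (e i).surjective
    HasFGFixed.exists_prime (HasFGFixed.of_equiv (h i) (e i))
  exact hR.hasFGFixed_of_prime hprime
end

section
/- Let G = F_2 × ℤ, where F_2 is the free group on generators a, b, and let σ_a : F_2 → ℤ be the homomorphism sending a ↦ 1 and b ↦ 0 (the exponent sum of a). Define f : G → G by f(w, m) = (w, m + σ_a(w)). Then f is an automorphism of G, its fixed subgroup is Fix(f) = {(w, m) ∈ F_2 × ℤ : σ_a(w) = 0} = (ker σ_a) × ℤ, which equals the subgroup generated by the infinite set {(1,1)} ∪ {(a^i b a^{-i}, 0) : i ∈ ℤ}, and Fix(f) is not finitely generated. -/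
/-- The exponent sum of the first generator `a`: the homomorphism `F₂ → ℤ` with
`a ↦ 1`, `b ↦ 0` (written multiplicatively). -/
def expSumA : FreeGroup (Fin 2) →* Multiplicative ℤ :=
  FreeGroup.lift fun i => if i = 0 then Multiplicative.ofAdd (1 : ℤ) else 1

/-- The endomorphism `f : F₂ × ℤ → F₂ × ℤ`, `f(w, m) = (w, m + σ_a(w))`. -/
def fTwoTimesZEndo : FreeGroup (Fin 2) × Multiplicative ℤ →*
    FreeGroup (Fin 2) × Multiplicative ℤ :=
  (MonoidHom.fst _ _).prod (MonoidHom.snd _ _ * expSumA.comp (MonoidHom.fst _ _))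

open FreeGroup in
/-- Every word `w` differs from a power of `a` by a product of conjugates `aⁱba⁻ⁱ`. -/
lemma conj_mul_zpow_expSumA_mem_closure (w : FreeGroup (Fin 2)) (i : ℤ) :
    of 0 ^ i * w * of 0 ^ (-(expSumA w).toAdd - i) ∈
      Subgroup.closure (Set.range fun j : ℤ =>
        (of 0 ^ j * of 1 * of 0 ^ (-j) : FreeGroup (Fin 2))) := by
  induction w using FreeGroup.induction_on generalizing i with
  | C1 => simp
  | of x =>
    fin_cases x
    · have h : (of 0 ^ i * of 0 * of 0 ^ (-1 - i) : FreeGroup (Fin 2)) = 1 := by group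
      simp [expSumA, h]
    · exact Subgroup.subset_closure ⟨i, by simp [expSumA]⟩
  | inv_of x ih =>
    have h := inv_mem (ih (i - (expSumA (of x)).toAdd))
    convert h using 1
    simp only [_root_.map_inv, toAdd_inv]
    group
  | mul v w hv hw =>
    have h := mul_mem (hv i) (hw (i + (expSumA v).toAdd))
    convert h using 1
    simp only [_root_.map_mul, toAdd_mul]
    group

lemma ker_expSumA_eq_closure :
    expSumA.ker = Subgroup.closure (Set.range fun j : ℤ =>
      (FreeGroup.of 0 ^ j * FreeGroup.of 1 * FreeGroup.of 0 ^ (-j) : FreeGroup (Fin 2))) := by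
  apply le_antisymm
  · intro w hw
    simpa [MonoidHom.mem_ker.mp hw] using conj_mul_zpow_expSumA_mem_closure w 0
  · rw [Subgroup.closure_le]
    rintro _ ⟨j, rfl⟩
    simp [MonoidHom.mem_ker, expSumA]

lemma Subgroup.FG.map {G K : Type*} [Group G] [Group K] {H : Subgroup G} (hH : H.FG)
    (f : G →* K) : (H.map f).FG := by
  rw [Subgroup.fg_iff_submonoid_fg] at hH ⊢
  exact Submonoid.FG.map hH f

/-- A finitely generated group of finitely supported permutations moves only finitely many
points. -/
lemma Subgroup.FG.finite_setOf_exists_apply_ne {α : Type*} {H : Subgroup (Equiv.Perm α)}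
    (hH : H.FG) (hfin : ∀ g ∈ H, {x | g x ≠ x}.Finite) :
    {x | ∃ g ∈ H, g x ≠ x}.Finite := by
  obtain ⟨S, rfl⟩ := hH
  refine (S.finite_toSet.biUnion fun g hg => hfin g (Subgroup.subset_closure hg)).subset ?_
  rintro x ⟨g, hg, hgx⟩
  by_contra hx
  simp only [Set.mem_iUnion, Set.mem_ofPred_eq, not_exists, not_not] at hx
  have hle : Subgroup.closure (S : Set (Equiv.Perm α)) ≤
      MulAction.stabilizer (Equiv.Perm α) x :=
    (Subgroup.closure_le _).mpr hx
  exact hgx (hle hg)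

/-- The action of `F₂` on `ℤ` in which `a` is the shift and `b` transposes `0` and `1`. -/
def shiftSwapHom : FreeGroup (Fin 2) →* Equiv.Perm ℤ :=
  FreeGroup.lift fun i => if i = 0 then Equiv.addRight 1 else Equiv.swap 0 1

lemma shiftSwapHom_conj (j : ℤ) :
    shiftSwapHom (FreeGroup.of 0 ^ j * FreeGroup.of 1 * FreeGroup.of 0 ^ (-j)) =
      Equiv.swap j (j + 1) := by
  have h : shiftSwapHom (FreeGroup.of 0 ^ j * FreeGroup.of 1 * FreeGroup.of 0 ^ (-j)) =
      (Equiv.addRight (1 : ℤ)) ^ j * Equiv.swap 0 1 * ((Equiv.addRight (1 : ℤ)) ^ j)⁻¹ := by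
    simp [shiftSwapHom]
  rw [h, ← Equiv.swap_apply_apply]
  simp [add_comm]

lemma finite_setOf_shiftSwapHom_apply_ne {w : FreeGroup (Fin 2)} (hw : w ∈ expSumA.ker) :
    {x | shiftSwapHom w x ≠ x}.Finite := by
  rw [ker_expSumA_eq_closure] at hw
  induction hw using Subgroup.closure_induction with
  | mem w hw =>
    obtain ⟨j, rfl⟩ := hw
    refine (Set.toFinite {j, j + 1}).subset fun x hx => ?_
    rw [Set.mem_ofPred_eq, shiftSwapHom_conj] at hx
    by_contra hne
    simp only [Set.mem_insert_iff, Set.mem_singleton_iff, not_or] at hne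
    exact hx (Equiv.swap_apply_of_ne_of_ne hne.1 hne.2)
  | one => simp
  | mul v w _ _ hv hw =>
    refine (hv.union hw).subset fun x hx => ?_
    by_contra hne
    simp only [Set.mem_union, Set.mem_ofPred_eq, not_or, not_not] at hne
    exact hx (by simp [hne.1, hne.2])
  | inv w _ hw =>
    refine hw.subset fun x hx h => hx ?_
    rw [map_inv, Equiv.Perm.inv_eq_iff_eq, h]

lemma expSumA_ker_not_fg : ¬ expSumA.ker.FG := by
  intro h
  have hfin := (Subgroup.FG.map h shiftSwapHom).finite_setOf_exists_apply_ne (by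
    rintro _ ⟨w, hw, rfl⟩
    exact finite_setOf_shiftSwapHom_apply_ne hw)
  refine Set.infinite_univ (hfin.subset fun j _ => ⟨_, Subgroup.mem_map_of_mem _
    (show FreeGroup.of 0 ^ j * FreeGroup.of 1 * FreeGroup.of 0 ^ (-j) ∈ expSumA.ker from ?_), ?_⟩)
  · simp [MonoidHom.mem_ker, expSumA]
  · rw [shiftSwapHom_conj, Equiv.swap_apply_left]
    lia

lemma fTwoTimesZEndo_apply (p : FreeGroup (Fin 2) × Multiplicative ℤ) :
    fTwoTimesZEndo p = (p.1, p.2 * expSumA p.1) := rfl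

lemma fTwoTimesZEndo_bijective : Function.Bijective fTwoTimesZEndo := by
  refine Function.bijective_iff_has_inverse.mpr
    ⟨fun p => (p.1, p.2 * (expSumA p.1)⁻¹), fun p => ?_, fun p => ?_⟩ <;>
  simp [fTwoTimesZEndo_apply]

lemma fixedSubgroup_fTwoTimesZEndo :
    fixedSubgroup fTwoTimesZEndo = expSumA.ker.prod ⊤ := by
  ext p
  change fTwoTimesZEndo p = p ↔ _
  simp [fTwoTimesZEndo_apply, Prod.ext_iff, Subgroup.mem_prod, MonoidHom.mem_ker]

lemma expSumA_ker_prod_top_eq_closure :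
    expSumA.ker.prod ⊤ = Subgroup.closure
      ({((1 : FreeGroup (Fin 2)), Multiplicative.ofAdd (1 : ℤ))} ∪
        {p | ∃ i : ℤ, p = ((FreeGroup.of 0) ^ i * FreeGroup.of 1 * (FreeGroup.of 0) ^ (-i),
          (1 : Multiplicative ℤ))}) := by
  apply le_antisymm
  · refine Subgroup.prod_le_iff.mpr ⟨?_, ?_⟩
    · rw [ker_expSumA_eq_closure, Subgroup.map_le_iff_le_comap, Subgroup.closure_le]
      rintro _ ⟨j, rfl⟩
      exact Subgroup.subset_closure (Or.inr ⟨j, rfl⟩)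
    · rintro _ ⟨m, -, rfl⟩
      have h := zpow_mem (Subgroup.subset_closure (Or.inl rfl) :
        ((1 : FreeGroup (Fin 2)), Multiplicative.ofAdd (1 : ℤ)) ∈ Subgroup.closure
          ({((1 : FreeGroup (Fin 2)), Multiplicative.ofAdd (1 : ℤ))} ∪
            {p | ∃ i : ℤ, p = ((FreeGroup.of 0) ^ i * FreeGroup.of 1 * (FreeGroup.of 0) ^ (-i),
              (1 : Multiplicative ℤ))})) m.toAdd
      simpa [Prod.pow_mk, ← ofAdd_zsmul] using h
  · rw [Subgroup.closure_le]
    rintro p (rfl | ⟨j, rfl⟩)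
    · simp [Subgroup.mem_prod]
    · simp [Subgroup.mem_prod, MonoidHom.mem_ker, expSumA]

/-- The map `f(w,m) = (w, m + σ_a(w))` on `F₂ × ℤ` is an automorphism whose fixed subgroup
is `{(w,m) : σ_a(w) = 0} = ker σ_a × ℤ`, which is generated by the infinite set
`{(1,1)} ∪ {(aⁱba⁻ⁱ, 0) : i ∈ ℤ}` and is not finitely generated. -/
theorem fixedSubgroup_of_fTwoTimesZEndo_not_fg :
    Function.Bijective fTwoTimesZEndo ∧
    fixedSubgroup fTwoTimesZEndo = (MonoidHom.ker expSumA).prod ⊤ ∧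
    fixedSubgroup fTwoTimesZEndo = Subgroup.closure
      ({((1 : FreeGroup (Fin 2)), Multiplicative.ofAdd (1 : ℤ))} ∪
        {p | ∃ i : ℤ, p = ((FreeGroup.of 0) ^ i * FreeGroup.of 1 * (FreeGroup.of 0) ^ (-i),
          (1 : Multiplicative ℤ))}) ∧
    ¬ Group.FG ↥(fixedSubgroup fTwoTimesZEndo) := by
  refine ⟨fTwoTimesZEndo_bijective, fixedSubgroup_fTwoTimesZEndo,
    fixedSubgroup_fTwoTimesZEndo.trans expSumA_ker_prod_top_eq_closure, fun hfg => ?_⟩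
  have h := Subgroup.FG.map ((Group.fg_iff_subgroup_fg _).mp hfg) (MonoidHom.fst _ (Multiplicative ℤ))
  rw [fixedSubgroup_fTwoTimesZEndo] at h
  refine expSumA_ker_not_fg ?_
  convert h
  ext w
  simp [Subgroup.mem_prod]
end

section
/- Let F_n be the free group of finite rank n and let φ be an endomorphism of F_n. Let φ^∞(F_n) = ⋂_{k ≥ 1} φ^k(F_n) be the stable image of φ. Then φ maps φ^∞(F_n) into itself, and the restriction φ_∞ : φ^∞(F_n) → φ^∞(F_n) is an automorphism (i.e., it is bijective). -/
/-- The `k`-th iterate of an endomorphism. -/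
def iterHom {G : Type*} [Group G] (φ : G →* G) : ℕ → (G →* G)
  | 0 => MonoidHom.id G
  | k + 1 => φ.comp (iterHom φ k)

/-- The stable image `φ^∞(G) = ⋂_{k ≥ 1} φ^k(G)` of an endomorphism `φ`. -/
def stableImage {G : Type*} [Group G] (φ : G →* G) : Subgroup G :=
  ⨅ k : ℕ, (iterHom φ (k + 1)).range

/-- For each `g`, a finite set `S` of group elements has a permutation which agrees with left
multiplication by `g` wherever the latter stays within `S`. -/
theorem Set.exists_perm_extending_mul_left {G : Type*} [Group G] (S : Set G) [Finite S] (g : G) :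
    ∃ σ : Equiv.Perm S, ∀ s t : S, g * (s : G) = (t : G) → σ s = t := by
  classical
  have := Fintype.ofFinite S
  let e : {s : S // g * (s : G) ∈ S} ≃ {t : S // g⁻¹ * (t : G) ∈ S} :=
    { toFun := fun s => ⟨⟨g * (s : S), s.2⟩, by simp⟩
      invFun := fun t => ⟨⟨g⁻¹ * (t : S), t.2⟩, by simp⟩
      left_inv := fun s => by simp
      right_inv := fun t => by simp }
  refine ⟨e.extendSubtype, fun s t h => ?_⟩
  have hs : g * (s : G) ∈ S := h ▸ t.2
  rw [Equiv.extendSubtype_apply_of_mem e s hs]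
  exact Subtype.ext h

namespace FreeGroup

variable {α : Type*}

theorem lift_perm_apply_one (S : Set (FreeGroup α)) (h_one : 1 ∈ S) (σ : α → Equiv.Perm S)
    (hσ : ∀ a, ∀ s t : S, of a * (s : FreeGroup α) = (t : FreeGroup α) → σ a s = t) :
    ∀ (L : List (α × Bool)) (_ : ∀ L', L' <:+ L → mk L' ∈ S),
      (lift σ (mk L) ⟨1, h_one⟩ : FreeGroup α) = mk L
  | [], _ => by simp [← one_eq_mk]
  | (a, b) :: L, hL => by
    have h_tail : mk L ∈ S := hL L (List.suffix_cons _ _)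
    have h_all : mk ((a, b) :: L) ∈ S := hL _ List.suffix_rfl
    have ih : lift σ (mk L) ⟨1, h_one⟩ = ⟨mk L, h_tail⟩ := Subtype.ext <|
      lift_perm_apply_one S h_one σ hσ L fun L' h => hL L' (h.trans (List.suffix_cons _ _))
    have h_cons : mk ((a, b) :: L) = mk [(a, b)] * mk L := by rw [mul_mk]; rfl
    suffices h : lift σ (mk ((a, b) :: L)) ⟨1, h_one⟩ = ⟨mk ((a, b) :: L), h_all⟩ from
      congrArg Subtype.val h
    cases b with
    | true =>
      have hm : lift σ (mk ((a, true) :: L)) = σ a * lift σ (mk L) := by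
        rw [h_cons, _root_.map_mul]; simp [lift_mk]
      rw [hm, Equiv.Perm.mul_apply, ih]
      exact hσ a _ _ h_cons.symm
    | false =>
      have hm : lift σ (mk ((a, false) :: L)) = (σ a)⁻¹ * lift σ (mk L) := by
        rw [h_cons, _root_.map_mul]; simp [lift_mk]
      rw [hm, Equiv.Perm.mul_apply, ih, Equiv.Perm.inv_eq_iff_eq]
      refine (hσ a _ _ ?_).symm
      have h_inv : mk [(a, false)] = (of a)⁻¹ := rfl
      simp [h_cons, h_inv]

/-- Free groups are residually finite. -/
instance residuallyFinite : Group.ResiduallyFinite (FreeGroup α) := by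
  classical
  refine Group.residuallyFinite_of_forall_exists_finite_monoidHom fun g hg => ?_
  let S : Set (FreeGroup α) := mk '' {L | L ∈ g.toWord.tails}
  have : Finite S := ((List.finite_toSet _).image _).to_subtype
  have hS : ∀ L, L <:+ g.toWord → mk L ∈ S := fun L hL => ⟨L, List.mem_tails _ _ |>.2 hL, rfl⟩
  have h_one : (1 : FreeGroup α) ∈ S := hS [] List.nil_suffix
  choose σ hσ using fun a : α => Set.exists_perm_extending_mul_left S (of a)
  refine ⟨Equiv.Perm S, inferInstance, inferInstance, lift σ, fun h => hg ?_⟩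
  have key := lift_perm_apply_one S h_one σ hσ g.toWord hS
  rw [mk_toWord, h] at key
  exact key.symm

end FreeGroup

theorem MonoidHom.precomp_injective {G H Q : Type*} [Group G] [Group H] [Group Q] {f : G →* H}
    (hf : Function.Surjective f) : Function.Injective fun u : H →* Q => u.comp f :=
  fun _ _ h => (MonoidHom.cancel_right hf).1 h

namespace FreeGroupBasis

variable {ι κ G H : Type*} [Group G] [Group H]

theorem residuallyFinite (b : FreeGroupBasis ι G) : Group.ResiduallyFinite G := by
  rw [Group.residuallyFinite_iff_forall_finiteIndexNormalSubgroup]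
  intro g hg
  have h := Group.eq_one_iff_forall_finiteIndexNormalSubroup (b.repr g) fun K =>
    hg (K.comap b.repr.toMonoidHom)
  simpa using h

theorem finite_of_surjective [Finite ι] (b : FreeGroupBasis ι G) (c : FreeGroupBasis κ H)
    {f : G →* H} (hf : Function.Surjective f) : Finite κ := by
  classical
  let Q := Multiplicative (ZMod 2)
  have : Finite (G →* Q) := Finite.of_equiv _ b.lift
  have : Finite (H →* Q) := Finite.of_injective _ (MonoidHom.precomp_injective hf)
  have : Finite (κ → Q) := Finite.of_equiv _ c.lift.symm
  refine Finite.of_injective (fun k : κ => (Pi.mulSingle k (Multiplicative.ofAdd 1) : κ → Q))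
    fun i j h => ?_
  by_contra hij
  have := congrFun h i
  beta_reduce at this
  rw [Pi.mulSingle_eq_same, Pi.mulSingle_eq_of_ne hij] at this
  exact absurd this (by decide)

theorem card_le_of_surjective [Finite ι] (b : FreeGroupBasis ι G) (c : FreeGroupBasis κ H)
    {f : G →* H} (hf : Function.Surjective f) : Nat.card κ ≤ Nat.card ι := by
  have := b.finite_of_surjective c hf
  let Q := Multiplicative (ZMod 2)
  have : Finite (G →* Q) := Finite.of_equiv _ b.lift
  have h := Nat.card_le_card_of_injective _ (MonoidHom.precomp_injective (Q := Q) hf)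
  rw [← Nat.card_congr b.lift, ← Nat.card_congr c.lift, Nat.card_fun, Nat.card_fun] at h
  have hQ : Nat.card Q = 2 := Nat.card_zmod 2
  rw [hQ] at h
  exact (Nat.pow_le_pow_iff_right one_lt_two).1 h

/-- A surjection between free groups of the same finite rank is injective. -/
theorem injective_of_surjective [Finite ι] (b : FreeGroupBasis ι G) (c : FreeGroupBasis κ H)
    {f : G →* H} (hf : Function.Surjective f) (h_card : Nat.card ι = Nat.card κ) :
    Function.Injective f := by
  have := b.finite_of_surjective c hf
  have := b.residuallyFinite
  rw [injective_iff_map_eq_one]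
  intro g hg
  refine Group.eq_one_iff_forall_finiteIndexNormalSubroup g fun K => ?_
  let Q := G ⧸ K.toSubgroup
  have : Finite Q := Subgroup.finite_quotient_of_finiteIndex
  have : Finite (G →* Q) := Finite.of_equiv _ b.lift
  have : Finite (H →* Q) := Finite.of_equiv _ c.lift
  have h_le : Nat.card (G →* Q) ≤ Nat.card (H →* Q) := by
    rw [← Nat.card_congr b.lift, ← Nat.card_congr c.lift, Nat.card_fun, Nat.card_fun, h_card]
  obtain ⟨u, hu⟩ := ((MonoidHom.precomp_injective (Q := Q) hf).bijective_of_nat_card_le h_le).2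
    (QuotientGroup.mk' K.toSubgroup)
  have h_mk : u (f g) = (g : Q) := DFunLike.congr_fun hu g
  rw [hg, map_one] at h_mk
  exact (QuotientGroup.eq_one_iff g).1 h_mk.symm

end FreeGroupBasis

section StableImage

variable {G : Type*} [Group G] (φ : G →* G)

theorem iterHom_succ_apply (k : ℕ) (x : G) : iterHom φ (k + 1) x = φ (iterHom φ k x) := rfl

theorem iterHom_apply_comm (k : ℕ) (x : G) : iterHom φ k (φ x) = φ (iterHom φ k x) := by
  induction k with
  | zero => rfl
  | succ k ih => rw [iterHom_succ_apply, ih, iterHom_succ_apply]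

theorem antitone_range_iterHom : Antitone fun k => (iterHom φ k).range := by
  refine antitone_nat_of_succ_le fun k => ?_
  rintro _ ⟨x, rfl⟩
  exact ⟨φ x, iterHom_apply_comm φ k x⟩

theorem mem_stableImage_iff {x : G} : x ∈ stableImage φ ↔ ∀ k, x ∈ (iterHom φ k).range := by
  rw [stableImage, Subgroup.mem_iInf]
  refine ⟨fun h k => antitone_range_iterHom φ k.le_succ (h k), fun h k => h (k + 1)⟩

theorem map_mem_range_iterHom_succ {k : ℕ} {x : G} (hx : x ∈ (iterHom φ k).range) :
    φ x ∈ (iterHom φ (k + 1)).range := by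
  obtain ⟨y, rfl⟩ := hx
  exact ⟨y, rfl⟩

theorem map_mem_stableImage {x : G} (hx : x ∈ stableImage φ) : φ x ∈ stableImage φ := by
  rw [stableImage, Subgroup.mem_iInf]
  exact fun k => map_mem_range_iterHom_succ φ ((mem_stableImage_iff φ).1 hx k)

/-- If `φ` is injective on some iterated image, then it restricts to an automorphism of its
stable image. -/
theorem bijective_restrict_stableImage {N : ℕ}
    (hN : Set.InjOn φ ((iterHom φ N).range : Set G)) :
    Function.Bijective ((φ.domRestrict (stableImage φ)).codRestrict (stableImage φ)
      fun x => map_mem_stableImage φ x.2) := by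
  constructor
  · intro x y h
    exact Subtype.ext <| hN ((mem_stableImage_iff φ).1 x.2 N) ((mem_stableImage_iff φ).1 y.2 N)
      (congrArg Subtype.val h)
  · rintro ⟨y, hy⟩
    have h_pre : ∀ k, ∃ x ∈ (iterHom φ k).range, φ x = y := fun k => by
      obtain ⟨z, hz⟩ := (mem_stableImage_iff φ).1 hy (k + 1)
      exact ⟨iterHom φ k z, ⟨z, rfl⟩, hz⟩
    obtain ⟨x, hx, hxy⟩ := h_pre N
    refine ⟨⟨x, (mem_stableImage_iff φ).2 fun k => ?_⟩, Subtype.ext hxy⟩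
    obtain ⟨z, hz, hzy⟩ := h_pre (max k N)
    have : z = x := hN (antitone_range_iterHom φ (le_max_right k N) hz) hx (hzy.trans hxy.symm)
    exact this ▸ antitone_range_iterHom φ (le_max_left k N) hz

/-- An endomorphism of a free group of finite rank is injective on some iterated image. -/
theorem FreeGroupBasis.exists_injOn_range_iterHom {ι : Type*} [Finite ι]
    (b : FreeGroupBasis ι G) : ∃ N, Set.InjOn φ ((iterHom φ N).range : Set G) := by
  have := b.isFreeGroup
  let c (k : ℕ) := IsFreeGroup.basis (iterHom φ k).range
  have h_fin (k : ℕ) : Finite (IsFreeGroup.Generators (iterHom φ k).range) :=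
    b.finite_of_surjective (c k) (iterHom φ k).rangeRestrict_surjective
  let r (k : ℕ) := Nat.card (IsFreeGroup.Generators (iterHom φ k).range)
  let f (k : ℕ) : (iterHom φ k).range →* (iterHom φ (k + 1)).range :=
    (φ.domRestrict _).codRestrict _ fun x => map_mem_range_iterHom_succ φ x.2
  have hf (k : ℕ) : Function.Surjective (f k) := by
    rintro ⟨_, x, rfl⟩
    exact ⟨⟨iterHom φ k x, x, rfl⟩, rfl⟩
  let N := Function.argmin r
  have h_card : r N = r (N + 1) :=
    le_antisymm (Function.argmin_le r (N + 1)) ((c N).card_le_of_surjective (c (N + 1)) (hf N))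
  refine ⟨N, fun x hx y hy hxy => ?_⟩
  have h_inj := (c N).injective_of_surjective (c (N + 1)) (hf N) h_card
  exact congrArg Subtype.val (@h_inj ⟨x, hx⟩ ⟨y, hy⟩ (Subtype.ext hxy))

end StableImage

/-- **Imrich–Turner.** For an endomorphism `φ` of a free group of finite rank, `φ` maps the
stable image `φ^∞(F_n)` into itself and restricts to an automorphism of it. -/
theorem stableImage_restriction_isAut_of_freeGroup (n : ℕ)
    (φ : FreeGroup (Fin n) →* FreeGroup (Fin n)) :
    (∀ x ∈ stableImage φ, φ x ∈ stableImage φ) ∧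
    ∃ ψ : ↥(stableImage φ) →* ↥(stableImage φ),
      (∀ x : ↥(stableImage φ), (ψ x : FreeGroup (Fin n)) = φ ↑x) ∧
      Function.Bijective ψ := by
  obtain ⟨N, hN⟩ := (FreeGroupBasis.ofFreeGroup (Fin n)).exists_injOn_range_iterHom φ
  exact ⟨fun _ => map_mem_stableImage φ, _, fun _ => rfl, bijective_restrict_stableImage φ hN⟩
end

section
/- Let G = ℤ ∗ ℤ² be the free product of the infinite cyclic group ⟨t⟩ and the free abelian group ℤ² = ⟨a, b⟩, and let φ be the endomorphism of G determined by φ(t) = t·a, φ(a) = a, φ(b) = b (where t, a, b denote the canonical images of the generators in G). Then φ is an automorphism of G, and its fixed subgroup Fix(φ) equals the subgroup of G generated by the canonical copy of ℤ² together with its conjugate t·ℤ²·t^{-1}; this fixed subgroup is isomorphic to ℤ² ∗ ℤ² and has rank 4 = 2·(rk(G) − 1). -/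
/-- The free product `ℤ ∗ ℤ²`. -/
abbrev GZZ2 : Type := Monoid.Coprod (Multiplicative ℤ) (Multiplicative (ℤ × ℤ))

/-- The generator `t` of the `ℤ` factor. -/
def tGen : GZZ2 := Monoid.Coprod.inl (Multiplicative.ofAdd (1 : ℤ))

/-- The generator `a` of the `ℤ²` factor. -/
def aGen : GZZ2 := Monoid.Coprod.inr (Multiplicative.ofAdd ((1, 0) : ℤ × ℤ))

/-- The generator `b` of the `ℤ²` factor. -/
def bGen : GZZ2 := Monoid.Coprod.inr (Multiplicative.ofAdd ((0, 1) : ℤ × ℤ))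

/-- The endomorphism of `ℤ ∗ ℤ²` determined by `t ↦ t·a`, `a ↦ a`, `b ↦ b`. -/
def phiZZ2 : GZZ2 →* GZZ2 :=
  Monoid.Coprod.lift (zpowersHom GZZ2 (tGen * aGen)) Monoid.Coprod.inr

namespace HNNExtension

open NormalWord

variable {A : Type*} [Group A]

/-- The free product of `A` with an infinite cyclic group, as an HNN extension of `A` along its
trivial subgroup. -/
abbrev Trivial (A : Type*) [Group A] : Type _ :=
  HNNExtension A (⊥ : Subgroup A) (⊥ : Subgroup A) (MulEquiv.refl _)

theorem toSubgroup_bot (u : ℤˣ) : toSubgroup (⊥ : Subgroup A) ⊥ u = ⊥ := by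
  simp [toSubgroup]

/-- The homomorphism out of `HNNExtension.Trivial A` given by its values on `A` and on `t`. -/
def trivialLift {H : Type*} [Group H] (f : A →* H) (x : H) : Trivial A →* H :=
  lift f x (by rintro ⟨y, hy⟩; obtain rfl := Subgroup.mem_bot.1 hy; simp)

@[simp]
theorem trivialLift_of {H : Type*} [Group H] (f : A →* H) (x : H) (y : A) :
    trivialLift f x (of y) = f y := lift_of ..

@[simp]
theorem trivialLift_t {H : Type*} [Group H] (f : A →* H) (x : H) :
    trivialLift f x t = x := lift_t ..

/-- The free product with an infinite cyclic group is an HNN extension along the trivial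
subgroup. -/
def trivialEquivCoprod : Trivial A ≃* Monoid.Coprod (Multiplicative ℤ) A :=
  MonoidHom.toMulEquiv
    (trivialLift Monoid.Coprod.inr (Monoid.Coprod.inl (Multiplicative.ofAdd 1)))
    (Monoid.Coprod.lift (zpowersHom _ t) of)
    (by ext <;> simp)
    (by ext <;> simp)

@[simp]
theorem trivialEquivCoprod_of (x : A) : trivialEquivCoprod (of x) = Monoid.Coprod.inr x :=
  trivialLift_of (H := Monoid.Coprod (Multiplicative ℤ) A) Monoid.Coprod.inr
    (Monoid.Coprod.inl (Multiplicative.ofAdd 1)) x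

@[simp]
theorem trivialEquivCoprod_t :
    trivialEquivCoprod (t : Trivial A) = Monoid.Coprod.inl (Multiplicative.ofAdd 1) :=
  trivialLift_t Monoid.Coprod.inr (Monoid.Coprod.inl (Multiplicative.ofAdd 1))

/-- The element `t ^ u₁ * x₁ * t ^ u₂ * x₂ * ⋯` represented by a list of pairs `(uᵢ, xᵢ)`. -/
def wordProd (l : List (ℤˣ × A)) : Trivial A :=
  (l.map fun x => t ^ (x.1 : ℤ) * of x.2).prod

@[simp]
theorem wordProd_nil : wordProd ([] : List (ℤˣ × A)) = 1 := rfl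

@[simp]
theorem wordProd_cons (p : ℤˣ × A) (l : List (ℤˣ × A)) :
    wordProd (p :: l) = t ^ (p.1 : ℤ) * of p.2 * wordProd l := by
  simp [wordProd]

/-- A list of pairs without a subword `t ^ u * 1 * t ^ (-u)`. -/
abbrev IsReducedList (l : List (ℤˣ × A)) : Prop :=
  l.IsChain fun p q => p.2 = 1 → p.1 = q.1

/-- The transversal pair of the trivial subgroup: all of `A`. -/
def transversalPairBot (A : Type*) [Group A] :
    TransversalPair A (⊥ : Subgroup A) (⊥ : Subgroup A) where
  set _ := Set.univ
  compl u := by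
    rw [toSubgroup_bot]
    exact Subgroup.isComplement_singleton_univ

/-- The normal word with a given head and a given reduced list. -/
def normalWordOfList (x : A) (l : List (ℤˣ × A)) (hl : IsReducedList l) :
    NormalWord (transversalPairBot A) where
  head := x
  toList := l
  chain := by simpa only [toSubgroup_bot, Subgroup.mem_bot] using hl
  mem_set _ _ _ := Set.mem_univ _

theorem exists_eq_of_mul_wordProd (g : Trivial A) :
    ∃ (x : A) (l : List (ℤˣ × A)), IsReducedList l ∧ g = of x * wordProd l := by
  obtain ⟨w, rfl⟩ :=
    (NormalWord.equiv (MulEquiv.refl _) (d := transversalPairBot A)).symm.surjective g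
  exact ⟨w.head, w.toList, by simpa only [toSubgroup_bot, Subgroup.mem_bot] using w.chain, rfl⟩

theorem of_mul_wordProd_inj {x y : A} {l m : List (ℤˣ × A)} (hl : IsReducedList l)
    (hm : IsReducedList m) (h : of x * wordProd l = of y * wordProd m) : x = y ∧ l = m := by
  have := NormalWord.prod_injective (MulEquiv.refl _) (transversalPairBot A)
    (a₁ := normalWordOfList x l hl) (a₂ := normalWordOfList y m hm) h
  exact ⟨congrArg (fun w => w.head) this, congrArg (fun w => w.toList) this⟩

/-- The endomorphism fixing `A` and sending `t` to `t * a`. -/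
def twist (a : A) : Trivial A →* Trivial A :=
  trivialLift of (t * of a)

@[simp]
theorem twist_of (a x : A) : twist a (of x) = of x := trivialLift_of ..

@[simp]
theorem twist_t (a : A) : twist a t = t * of a := trivialLift_t ..

/-- The element that the twist of a word inserts in front of it. -/
def leadingShift (a : A) : List (ℤˣ × A) → A
  | [] => 1
  | p :: _ => if p.1 = 1 then 1 else a⁻¹

/-- The reduced list of the twist of a word. -/
def twistList (a : A) : List (ℤˣ × A) → List (ℤˣ × A)
  | [] => []
  | p :: l => (p.1, (if p.1 = 1 then a else 1) * p.2 * leadingShift a l) :: twistList a l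

theorem twist_wordProd (a : A) (l : List (ℤˣ × A)) :
    twist a (wordProd l) = of (leadingShift a l) * wordProd (twistList a l) := by
  induction l with
  | nil => simp [leadingShift, twistList]
  | cons p l ih =>
    obtain ⟨u, x⟩ := p
    rcases Int.units_eq_one_or u with rfl | rfl <;>
      simp [ih, leadingShift.eq_2, twistList, mul_assoc]

theorem isReducedList_twistList (a : A) {l : List (ℤˣ × A)} (hl : IsReducedList l) :
    IsReducedList (twistList a l) := by
  induction l with
  | nil => exact List.isChain_nil
  | cons p l ih =>
    cases l with
    | nil => exact List.isChain_singleton _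
    | cons q l =>
      have hpq := List.isChain_cons_cons.1 hl
      refine List.isChain_cons_cons.2 ⟨?_, ih hpq.2⟩
      obtain ⟨u, x⟩ := p
      obtain ⟨v, y⟩ := q
      have := hpq.1
      rcases Int.units_eq_one_or u with rfl | rfl <;>
        rcases Int.units_eq_one_or v with rfl | rfl <;>
        simp_all [leadingShift, mul_inv_eq_one]

theorem wordProd_mem_of_twistList_eq {a : A} (ha : a ≠ 1) {K : Subgroup (Trivial A)}
    (hK : ∀ x, of x ∈ K) (hKt : ∀ x, t * of x * t⁻¹ ∈ K) :
    ∀ l : List (ℤˣ × A), leadingShift a l = 1 → twistList a l = l → wordProd l ∈ K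
  | [], _, _ => by simp
  | [(u, x)], h, h' => by
    rcases Int.units_eq_one_or u with rfl | rfl <;> simp_all [leadingShift, twistList]
  | (u, x) :: (v, y) :: l, h, h' => by
    have ih := wordProd_mem_of_twistList_eq ha hK hKt l
    rcases Int.units_eq_one_or u with rfl | rfl
    · rcases Int.units_eq_one_or v with rfl | rfl
      · simp_all [leadingShift, twistList]
      · simp only [twistList, List.cons.injEq, Prod.mk.injEq] at h'
        have hl : leadingShift a l = 1 := by simpa using h'.2.1.2
        have := K.mul_mem (K.mul_mem (hKt x) (hK y)) (ih hl h'.2.2)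
        simpa [mul_assoc] using this
    · simp_all [leadingShift]

theorem mem_of_twist_eq {a : A} (ha : a ≠ 1) {K : Subgroup (Trivial A)}
    (hK : ∀ x, of x ∈ K) (hKt : ∀ x, t * of x * t⁻¹ ∈ K) {g : Trivial A}
    (hg : twist a g = g) : g ∈ K := by
  obtain ⟨x, l, hl, rfl⟩ := exists_eq_of_mul_wordProd g
  have key : of (x * leadingShift a l) * wordProd (twistList a l) = of x * wordProd l := by
    rwa [map_mul, twist_wordProd, twist_of, ← mul_assoc, ← map_mul] at hg
  obtain ⟨h₁, h₂⟩ := of_mul_wordProd_inj (isReducedList_twistList a hl) hl key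
  exact K.mul_mem (hK x)
    (wordProd_mem_of_twistList_eq ha hK hKt l (mul_eq_left.1 h₁) h₂)

end HNNExtension

namespace Monoid.Coprod

open Multiplicative

/-- The homomorphism `A ∗ A →* ℤ ∗ A` onto the subgroup generated by `A` and `t * A * t⁻¹`. -/
def conjLift (A : Type*) [Group A] : Coprod A A →* Coprod (Multiplicative ℤ) A :=
  lift inr ((MulAut.conj (inl (ofAdd 1))).toMonoidHom.comp inr)

theorem conjLift_injective (A : Type*) [Group A] : Function.Injective (conjLift A) := by
  let s : Multiplicative ℤ →* MulAut (Coprod A A) := zpowersHom _ (MulEquiv.coprodComm A A)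
  let r : Coprod (Multiplicative ℤ) A →* Coprod A A ⋊[s] Multiplicative ℤ :=
    lift SemidirectProduct.inr (SemidirectProduct.inl.comp inl)
  have hr : r.comp (conjLift A) = SemidirectProduct.inl := by
    ext x : 2
    · simp [r, conjLift]
    · have h := SemidirectProduct.inl_aut (φ := s) (ofAdd 1) (inl x)
      simpa [r, conjLift, s] using h.symm
  refine Function.Injective.of_comp (f := r) ?_
  rw [← MonoidHom.coe_comp, hr]
  exact SemidirectProduct.inl_injective

theorem range_conjLift (A : Type*) [Group A] :
    (conjLift A).range = (inr : A →* Coprod (Multiplicative ℤ) A).range ⊔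
      Subgroup.map (MulAut.conj (inl (ofAdd 1))).toMonoidHom
        (inr : A →* Coprod (Multiplicative ℤ) A).range := by
  rw [conjLift, range_lift, MonoidHom.range_comp]

theorem closure_range_sumElim {G H ι κ : Type*} [Group G] [Group H] {v : ι → G} {w : κ → H}
    (hv : Subgroup.closure (Set.range v) = ⊤) (hw : Subgroup.closure (Set.range w) = ⊤) :
    Subgroup.closure (Set.range (Sum.elim (inl ∘ v) (inr ∘ w) : ι ⊕ κ → Coprod G H)) = ⊤ := by
  rw [Set.Sum.elim_range, Set.range_comp, Set.range_comp, Subgroup.closure_union,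
    ← MonoidHom.map_closure, ← MonoidHom.map_closure, hv, hw, ← MonoidHom.range_eq_map,
    ← MonoidHom.range_eq_map, range_inl_sup_range_inr]

end Monoid.Coprod

namespace Group

theorem fg_of_closure_range_eq_top {G ι : Type*} [Group G] [Finite ι] {v : ι → G}
    (hv : Subgroup.closure (Set.range v) = ⊤) : Group.FG G :=
  Group.fg_iff.2 ⟨_, hv, Set.finite_range v⟩

theorem rank_le_card_of_closure_range_eq_top {G ι : Type*} [Group G] [Group.FG G] [Fintype ι]
    {v : ι → G} (hv : Subgroup.closure (Set.range v) = ⊤) : Group.rank G ≤ Fintype.card ι := by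
  classical
  exact (Group.rank_le (S := Finset.univ.image v) (by simpa using hv)).trans
    Finset.card_image_le

theorem finrank_le_rank_of_surjective {G M : Type*} [Group G] [Group.FG G] [AddCommGroup M]
    (f : G →* Multiplicative M) (hf : Function.Surjective f) :
    Module.finrank ℤ M ≤ Group.rank G := by
  obtain ⟨S, hS, hcl⟩ := Group.rank_spec G
  let v : S → M := fun s => (f s).toAdd
  have hv : Submodule.span ℤ (Set.range v) = ⊤ := by
    refine eq_top_iff.2 fun m _ => ?_
    obtain ⟨g, hg⟩ := hf (Multiplicative.ofAdd m)
    have hmem : (f g).toAdd ∈ Submodule.span ℤ (Set.range v) := by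
      have hgS : g ∈ Subgroup.closure (S : Set G) := hcl ▸ Subgroup.mem_top g
      induction hgS using Subgroup.closure_induction generalizing m with
      | mem x hx => exact Submodule.subset_span ⟨⟨x, hx⟩, rfl⟩
      | one => simp
      | mul x y _ _ hx hy =>
        simpa using Submodule.add_mem _ (hx _ trivial rfl) (hy _ trivial rfl)
      | inv x _ hx => simpa using Submodule.neg_mem _ (hx _ trivial rfl)
    simpa [hg] using hmem
  simpa [hS] using finrank_le_of_span_eq_top hv

end Group

namespace Monoid.Coprod

theorem rank_multiplicative_eq {M N ι κ : Type*} [AddCommGroup M] [AddCommGroup N]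
    [Fintype ι] [Fintype κ] {v : ι → Multiplicative M} {w : κ → Multiplicative N}
    (hv : Subgroup.closure (Set.range v) = ⊤) (hw : Subgroup.closure (Set.range w) = ⊤)
    (hcard : Module.finrank ℤ (M × N) = Fintype.card ι + Fintype.card κ)
    [Group.FG (Coprod (Multiplicative M) (Multiplicative N))] :
    Group.rank (Coprod (Multiplicative M) (Multiplicative N)) =
      Fintype.card ι + Fintype.card κ := by
  refine le_antisymm ?_ ?_
  · simpa using Group.rank_le_card_of_closure_range_eq_top (closure_range_sumElim hv hw)
  · rw [← hcard]
    exact Group.finrank_le_rank_of_surjective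
      ((MulEquiv.prodMultiplicative M N).symm.toMonoidHom.comp toProd)
      ((MulEquiv.prodMultiplicative M N).symm.surjective.comp toProd_surjective)

end Monoid.Coprod

open Multiplicative

theorem closure_range_ofAdd_one :
    Subgroup.closure (Set.range fun _ : Unit => ofAdd (1 : ℤ)) = ⊤ := by
  refine eq_top_iff.2 fun n _ => ?_
  have h : n = ofAdd (1 : ℤ) ^ n.toAdd := by rw [← ofAdd_zsmul]; simp
  rw [h]
  exact Subgroup.zpow_mem _ (Subgroup.subset_closure (Set.mem_range_self ())) _

theorem closure_range_ofAdd_basis_prod :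
    Subgroup.closure (Set.range ![ofAdd ((1, 0) : ℤ × ℤ), ofAdd ((0, 1) : ℤ × ℤ)]) = ⊤ := by
  refine eq_top_iff.2 fun n _ => ?_
  have h : n = ofAdd ((1, 0) : ℤ × ℤ) ^ n.toAdd.1 * ofAdd ((0, 1) : ℤ × ℤ) ^ n.toAdd.2 := by
    rw [← ofAdd_zsmul, ← ofAdd_zsmul, ← ofAdd_add]
    simp
  rw [h]
  exact mul_mem (Subgroup.zpow_mem _ (Subgroup.subset_closure (Set.mem_range_self (0 : Fin 2))) _)
    (Subgroup.zpow_mem _ (Subgroup.subset_closure (Set.mem_range_self (1 : Fin 2))) _)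

theorem phiZZ2_tGen : phiZZ2 tGen = tGen * aGen := by
  simp [phiZZ2, tGen]

theorem phiZZ2_inr (x : Multiplicative (ℤ × ℤ)) :
    phiZZ2 (Monoid.Coprod.inr x) = Monoid.Coprod.inr x := by
  simp [phiZZ2]

theorem phiZZ2_aGen : phiZZ2 aGen = aGen := phiZZ2_inr _

theorem phiZZ2_bijective : Function.Bijective phiZZ2 := by
  let ψ : GZZ2 →* GZZ2 :=
    Monoid.Coprod.lift (zpowersHom GZZ2 (tGen * aGen⁻¹)) Monoid.Coprod.inr
  have hψt : ψ tGen = tGen * aGen⁻¹ := by simp [ψ, tGen]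
  have hψ (x) : ψ (Monoid.Coprod.inr x) = Monoid.Coprod.inr x := by simp [ψ]
  have hψa : ψ aGen = aGen := hψ _
  have h₁ : ψ.comp phiZZ2 = MonoidHom.id _ := by
    refine Monoid.Coprod.hom_ext (MonoidHom.ext_mint ?_) (MonoidHom.ext fun x => ?_)
    · change ψ (phiZZ2 tGen) = tGen
      rw [phiZZ2_tGen, map_mul, hψt, hψa, inv_mul_cancel_right]
    · simp [phiZZ2_inr, hψ]
  have h₂ : phiZZ2.comp ψ = MonoidHom.id _ := by
    refine Monoid.Coprod.hom_ext (MonoidHom.ext_mint ?_) (MonoidHom.ext fun x => ?_)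
    · change phiZZ2 (ψ tGen) = tGen
      rw [hψt, map_mul, map_inv, phiZZ2_tGen, phiZZ2_aGen, mul_inv_cancel_right]
    · simp [phiZZ2_inr, hψ]
  exact Function.bijective_iff_has_inverse.2 ⟨ψ, DFunLike.congr_fun h₁, DFunLike.congr_fun h₂⟩

theorem phiZZ2_trivialEquivCoprod (x : HNNExtension.Trivial (Multiplicative (ℤ × ℤ))) :
    phiZZ2 (HNNExtension.trivialEquivCoprod x) =
      HNNExtension.trivialEquivCoprod (HNNExtension.twist (ofAdd ((1, 0) : ℤ × ℤ)) x) := by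
  suffices h : phiZZ2.comp HNNExtension.trivialEquivCoprod.toMonoidHom =
      HNNExtension.trivialEquivCoprod.toMonoidHom.comp (HNNExtension.twist (ofAdd ((1, 0) : ℤ × ℤ))) from
    DFunLike.congr_fun h x
  refine HNNExtension.hom_ext (MonoidHom.ext fun y => ?_) ?_
  · simp [phiZZ2_inr]
  · simpa [tGen, aGen] using phiZZ2_tGen

theorem fixedSubgroup_phiZZ2 :
    fixedSubgroup phiZZ2 = (Monoid.Coprod.conjLift (Multiplicative (ℤ × ℤ))).range := by
  refine le_antisymm (fun g (hg : phiZZ2 g = g) => ?_) ?_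
  · obtain ⟨x, rfl⟩ := HNNExtension.trivialEquivCoprod.surjective g
    rw [phiZZ2_trivialEquivCoprod, EmbeddingLike.apply_eq_iff_eq] at hg
    refine HNNExtension.mem_of_twist_eq (a := ofAdd ((1, 0) : ℤ × ℤ)) (by decide)
      (K := (Monoid.Coprod.conjLift _).range.comap
        HNNExtension.trivialEquivCoprod.toMonoidHom) (fun y => ?_) (fun y => ?_) hg
    · exact ⟨Monoid.Coprod.inl y, by simp [Monoid.Coprod.conjLift]⟩
    · exact ⟨Monoid.Coprod.inr y, by simp [Monoid.Coprod.conjLift]⟩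
  · rw [Monoid.Coprod.conjLift, Monoid.Coprod.range_lift, sup_le_iff]
    constructor
    · rintro _ ⟨y, rfl⟩
      exact phiZZ2_inr y
    · rintro _ ⟨y, rfl⟩
      change phiZZ2 (tGen * Monoid.Coprod.inr y * tGen⁻¹) = tGen * Monoid.Coprod.inr y * tGen⁻¹
      have hcomm : aGen * Monoid.Coprod.inr y = Monoid.Coprod.inr y * aGen := by
        rw [aGen, ← map_mul, mul_comm, map_mul]
      rw [map_mul, map_mul, map_inv, phiZZ2_tGen, phiZZ2_inr, mul_assoc tGen, hcomm]
      group

/-- The fixed subgroup of `phiZZ2` is the free product of two copies of `ℤ²`. -/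
noncomputable def fixedSubgroupPhiZZ2Equiv :
    ↥(fixedSubgroup phiZZ2) ≃*
      Monoid.Coprod (Multiplicative (ℤ × ℤ)) (Multiplicative (ℤ × ℤ)) :=
  (MulEquiv.subgroupCongr fixedSubgroup_phiZZ2).trans
    (MonoidHom.ofInjective (Monoid.Coprod.conjLift_injective _)).symm

/-- The endomorphism `φ` of `G = ℤ ∗ ℤ²` with `φ(t) = t·a`, `φ(a) = a`, `φ(b) = b` is an
automorphism whose fixed subgroup is generated by the canonical copy of `ℤ²` together with
its conjugate `t·ℤ²·t⁻¹`; it is isomorphic to `ℤ² ∗ ℤ²` and has rank `4 = 2·(rk(G) − 1)`. -/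
theorem fixedSubgroup_of_phiZZ2 :
    phiZZ2 tGen = tGen * aGen ∧ phiZZ2 aGen = aGen ∧ phiZZ2 bGen = bGen ∧
    Function.Bijective phiZZ2 ∧
    fixedSubgroup phiZZ2 =
      (Monoid.Coprod.inr : Multiplicative (ℤ × ℤ) →* GZZ2).range ⊔
        Subgroup.map (MulAut.conj tGen).toMonoidHom
          (Monoid.Coprod.inr : Multiplicative (ℤ × ℤ) →* GZZ2).range ∧
    Nonempty (↥(fixedSubgroup phiZZ2) ≃*
      Monoid.Coprod (Multiplicative (ℤ × ℤ)) (Multiplicative (ℤ × ℤ))) ∧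
    (∃ hfix : Group.FG ↥(fixedSubgroup phiZZ2),
      ∃ hG : Group.FG GZZ2,
        @Group.rank _ _ hfix = 4 ∧ @Group.rank _ _ hG = 3 ∧
        @Group.rank _ _ hfix = 2 * (@Group.rank _ _ hG - 1)) := by
  have hG : Group.FG GZZ2 := Group.fg_of_closure_range_eq_top
    (Monoid.Coprod.closure_range_sumElim closure_range_ofAdd_one closure_range_ofAdd_basis_prod)
  have hC : Group.FG (Monoid.Coprod (Multiplicative (ℤ × ℤ)) (Multiplicative (ℤ × ℤ))) :=
    Group.fg_of_closure_range_eq_top (Monoid.Coprod.closure_range_sumElim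
      closure_range_ofAdd_basis_prod closure_range_ofAdd_basis_prod)
  have hfix : Group.FG ↥(fixedSubgroup phiZZ2) :=
    Group.fg_of_surjective (f := fixedSubgroupPhiZZ2Equiv.symm.toMonoidHom)
      fixedSubgroupPhiZZ2Equiv.symm.surjective
  have hrankG : Group.rank GZZ2 = 3 := by
    simpa using Monoid.Coprod.rank_multiplicative_eq closure_range_ofAdd_one
      closure_range_ofAdd_basis_prod (by simp)
  have hrank : Group.rank ↥(fixedSubgroup phiZZ2) = 4 := by
    rw [Group.rank_congr fixedSubgroupPhiZZ2Equiv]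
    simpa using Monoid.Coprod.rank_multiplicative_eq closure_range_ofAdd_basis_prod
      closure_range_ofAdd_basis_prod (by simp)
  refine ⟨phiZZ2_tGen, phiZZ2_aGen, phiZZ2_inr _, phiZZ2_bijective, ?_,
    ⟨fixedSubgroupPhiZZ2Equiv⟩, hfix, hG, hrank, hrankG, ?_⟩
  · rw [fixedSubgroup_phiZZ2, Monoid.Coprod.range_conjLift]
    rfl
  · rw [hrank, hrankG]
end
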